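/- arXiv:2202.03020 — 2 statements merged into one kernel-verified Lean document; each statement's English description precedes it below -/
import Mathlib

section
/- (Proposition 2.3: local well-posedness in FL¹ and Picard series expansion.) For every μ ∈ {1,−1} there exists δ > 0 such that for every u₀ with û₀ ∈ L¹(ℝ^d), setting T := δ ‖û₀‖_{L¹}^{−4}, there exists a unique mild FL¹ solution u of i∂_t u + Δ²u + μ|u|⁴u = 0 on [0,T] with u(0) = u₀. Moreover, for every t ∈ [0,T], û(t) = Σ_{j=0}^∞ F[Θ_j(u₀)(t)], and the series converges absolutely in L¹(ℝ^d), uniformly in t ∈ [0,T]. -/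
open MeasureTheory

noncomputable section

abbrev Ed (d : ℕ) := EuclideanSpace ℝ (Fin d)

def fconv {d : ℕ} (f g : Ed d → ℂ) : Ed d → ℂ := fun ξ => ∫ η, f η * g (ξ - η)

def ftild {d : ℕ} (f : Ed d → ℂ) : Ed d → ℂ := fun η => (starRingEnd ℂ) (f (-η))

inductive Tree5 : Type where
  | leaf : Tree5
  | node : Tree5 → Tree5 → Tree5 → Tree5 → Tree5 → Tree5

def Tree5.internal : Tree5 → ℕ
  | .leaf => 0
  | .node a b c d e => a.internal + b.internal + c.internal + d.internal + e.internal + 1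

/-- The Fourier transform `F[Ψ_φ(T)(t)]` of the tree distribution, defined by recursion. -/
def FPsi (d : ℕ) (μ : ℝ) (g : Ed d → ℂ) : Tree5 → ℝ → Ed d → ℂ
  | .leaf => fun t ξ => Complex.exp (Complex.I * ((t : ℂ) * (‖ξ‖ : ℂ) ^ 4)) * g ξ
  | .node T1 T2 T3 T4 T5 => fun t ξ =>
      Complex.I * (μ : ℂ) * Complex.exp (Complex.I * ((t : ℂ) * (‖ξ‖ : ℂ) ^ 4)) *
        ∫ τ in (0:ℝ)..t,
          Complex.exp (-(Complex.I * ((τ : ℂ) * (‖ξ‖ : ℂ) ^ 4))) *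
            fconv (fconv (fconv (fconv (FPsi d μ g T1 τ) (ftild (FPsi d μ g T2 τ)))
              (FPsi d μ g T3 τ)) (ftild (FPsi d μ g T4 τ))) (FPsi d μ g T5 τ) ξ

/-- The Fourier transform of `Θ_j(φ)(t)`, the `j`-th term of the Picard series expansion. -/
def FTheta (d : ℕ) (μ : ℝ) (g : Ed d → ℂ) (j : ℕ) (t : ℝ) : Ed d → ℂ :=
  fun ξ => ∑' T : {T : Tree5 // T.internal = j}, FPsi d μ g T t ξ

open Filter Set
open scoped ENNReal Topology

/-- A mild `FL¹` solution of `i∂ₜu + Δ²u + μ|u|⁴u = 0` on `[0,T]`, described through the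
Fourier transform `U t = 𝓕(u(t))`: `t ↦ û(t)` is continuous into `L¹` and the Duhamel
formula holds on the Fourier side, with initial datum `u0hat = û₀`. -/
def IsMildFL1Solution (d : ℕ) (μ T : ℝ) (u0hat : Ed d → ℂ) (U : ℝ → Ed d → ℂ) : Prop :=
  (∀ t ∈ Icc (0:ℝ) T, Integrable (U t)) ∧
  (∀ t₀ ∈ Icc (0:ℝ) T,
    Tendsto (fun t => eLpNorm (U t - U t₀) 1 volume) (𝓝[Icc (0:ℝ) T] t₀) (𝓝 0)) ∧
  (∀ t ∈ Icc (0:ℝ) T, ∀ᵐ ξ : Ed d, U t ξ =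
    Complex.exp (Complex.I * ((t : ℂ) * (‖ξ‖ : ℂ) ^ 4)) * u0hat ξ +
    Complex.I * (μ : ℂ) * ∫ τ in (0:ℝ)..t,
      Complex.exp (Complex.I * (((t - τ : ℝ) : ℂ) * (‖ξ‖ : ℂ) ^ 4)) *
        fconv (fconv (fconv (fconv (U τ) (ftild (U τ))) (U τ)) (ftild (U τ))) (U τ) ξ)

section ConvolutionL1

variable {d : ℕ}

/-- The `L¹` norm of a function on frequency space, as an extended nonnegative real. -/
def l1norm (f : Ed d → ℂ) : ℝ≥0∞ := ∫⁻ ξ, ‖f ξ‖ₑ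

theorem eLpNorm_one_eq_l1norm (f : Ed d → ℂ) : eLpNorm f 1 volume = l1norm f :=
  eLpNorm_one_eq_lintegral_enorm

theorem l1norm_congr {f g : Ed d → ℂ} (h : f =ᵐ[volume] g) : l1norm f = l1norm g :=
  lintegral_congr_ae (h.mono fun x hx => by simp only [hx])

theorem fconv_congr {f f' g g' : Ed d → ℂ} (hf : f =ᵐ[volume] f') (hg : g =ᵐ[volume] g') :
    fconv f g = fconv f' g' := by
  funext ξ
  refine integral_congr_ae ?_
  have h := (quasiMeasurePreserving_sub_left_of_right_invariant
    (volume : Measure (Ed d)) ξ).ae_eq_comp hg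
  filter_upwards [hf, h] with η h1 h2
  simp only [Function.comp_apply] at h2
  rw [h1, h2]

theorem ftild_congr {f g : Ed d → ℂ} (h : f =ᵐ[volume] g) : ftild f =ᵐ[volume] ftild g := by
  have h' := (Measure.measurePreserving_neg
    (volume : Measure (Ed d))).quasiMeasurePreserving.ae_eq_comp h
  filter_upwards [h'] with η h2
  simp only [Function.comp_apply] at h2
  simp only [ftild, h2]

theorem measurable_ftild_uncurry {X : Type*} [MeasurableSpace X] {F : X → Ed d → ℂ}
    (hF : Measurable (Function.uncurry F)) :
    Measurable (Function.uncurry fun x => ftild (F x)) := by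
  have : Measurable fun p : X × Ed d => F p.1 (-p.2) :=
    hF.comp (measurable_fst.prodMk measurable_snd.neg)
  exact Complex.continuous_conj.measurable.comp this

theorem measurable_fconv_uncurry {X : Type*} [MeasurableSpace X] {F G : X → Ed d → ℂ}
    (hF : Measurable (Function.uncurry F)) (hG : Measurable (Function.uncurry G)) :
    Measurable (Function.uncurry fun x => fconv (F x) (G x)) := by
  have h1 : Measurable fun p : (X × Ed d) × Ed d => F p.1.1 p.2 :=
    hF.comp (measurable_fst.fst.prodMk measurable_snd)
  have h2 : Measurable fun p : (X × Ed d) × Ed d => G p.1.1 (p.1.2 - p.2) :=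
    hG.comp (measurable_fst.fst.prodMk (measurable_fst.snd.sub measurable_snd))
  have h := StronglyMeasurable.integral_prod_right (ν := (volume : Measure (Ed d)))
    (f := fun (p : X × Ed d) η => F p.1 η * G p.1 (p.2 - η)) (h1.mul h2).stronglyMeasurable
  exact h.measurable

theorem measurable_slice {X : Type*} [MeasurableSpace X] {F : X → Ed d → ℂ}
    (hF : Measurable (Function.uncurry F)) (x : X) : Measurable (F x) :=
  hF.comp measurable_prodMk_left

theorem measurable_uncurry_const {f : Ed d → ℂ} (hf : Measurable f) :
    Measurable (Function.uncurry fun _ : Unit => f) := hf.comp measurable_snd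

theorem measurable_ftild {f : Ed d → ℂ} (hf : Measurable f) : Measurable (ftild f) :=
  measurable_slice (measurable_ftild_uncurry (measurable_uncurry_const hf)) ()

theorem measurable_fconv {f g : Ed d → ℂ} (hf : Measurable f) (hg : Measurable g) :
    Measurable (fconv f g) :=
  measurable_slice (measurable_fconv_uncurry (measurable_uncurry_const hf)
    (measurable_uncurry_const hg)) ()

theorem measurable_l1norm {X : Type*} [MeasurableSpace X] {F : X → Ed d → ℂ}
    (hF : Measurable (Function.uncurry F)) : Measurable fun x => l1norm (F x) :=
  Measurable.lintegral_prod_right' (f := fun p : X × Ed d => ‖Function.uncurry F p‖ₑ) hF.enorm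

theorem l1norm_ftild (f : Ed d → ℂ) : l1norm (ftild f) = l1norm f := by
  simp only [l1norm, ftild, RCLike.enorm_conj]
  exact lintegral_neg_eq_self (fun ξ => ‖f ξ‖ₑ)

theorem lintegral_lintegral_mul_sub {f g : Ed d → ℂ} (hf : Measurable f) (hg : Measurable g) :
    ∫⁻ ξ, ∫⁻ η, ‖f η * g (ξ - η)‖ₑ = l1norm f * l1norm g := by
  rw [lintegral_lintegral_swap]
  · simp only [enorm_mul]
    have : ∀ η, ∫⁻ ξ, ‖f η‖ₑ * ‖g (ξ - η)‖ₑ = ‖f η‖ₑ * l1norm g := fun η => by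
      rw [lintegral_const_mul _ (show Measurable fun ξ => ‖g (ξ - η)‖ₑ from
        (hg.comp (measurable_id.sub_const η)).enorm)]
      congr 1
      exact lintegral_sub_right_eq_self (fun ξ => ‖g ξ‖ₑ) η
    simp only [this]
    exact lintegral_mul_const _ hf.enorm
  · refine Measurable.aemeasurable ?_
    exact ((hf.comp measurable_snd).mul
      (hg.comp (measurable_fst.sub measurable_snd))).enorm

theorem l1norm_fconv_le {f g : Ed d → ℂ} (hf : Measurable f) (hg : Measurable g) :
    l1norm (fconv f g) ≤ l1norm f * l1norm g := by
  rw [← lintegral_lintegral_mul_sub hf hg]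
  exact lintegral_mono fun ξ => enorm_integral_le_lintegral_enorm _

/-- `f` is the sum of a series of measurable functions converging absolutely in `L¹`. -/
structure IsL1Sum {ι : Type*} (F : ι → Ed d → ℂ) (f : Ed d → ℂ) : Prop where
  measurable_term : ∀ i, Measurable (F i)
  tsum_ne_top : ∑' i, l1norm (F i) ≠ ⊤
  measurable_sum : Measurable f
  ae_eq : ∀ᵐ ξ, f ξ = ∑' i, F i ξ

theorem ae_tsum_enorm_ne_top {ι : Type*} [Countable ι] {F : ι → Ed d → ℂ}
    (hm : ∀ i, Measurable (F i)) (hs : ∑' i, l1norm (F i) ≠ ⊤) :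
    ∀ᵐ ξ, ∑' i, ‖F i ξ‖ₑ ≠ ⊤ := by
  have h : ∫⁻ ξ, ∑' i, ‖F i ξ‖ₑ ≠ ⊤ := by
    rwa [lintegral_tsum fun i => (hm i).enorm.aemeasurable]
  exact (ae_lt_top (Measurable.tsum fun i => (hm i).enorm) h).mono fun ξ => LT.lt.ne

theorem IsL1Sum.ae_summable {ι : Type*} [Countable ι] {F : ι → Ed d → ℂ} {f : Ed d → ℂ}
    (h : IsL1Sum F f) : ∀ᵐ ξ, Summable fun i => ‖F i ξ‖ :=
  (ae_tsum_enorm_ne_top h.measurable_term h.tsum_ne_top).mono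
    fun _ hξ => tsum_enorm_ne_top_iff_summable_norm.1 hξ

theorem IsL1Sum.l1norm_le {ι : Type*} [Countable ι] {F : ι → Ed d → ℂ} {f : Ed d → ℂ}
    (h : IsL1Sum F f) : l1norm f ≤ ∑' i, l1norm (F i) := by
  calc l1norm f = ∫⁻ ξ, ‖∑' i, F i ξ‖ₑ := l1norm_congr h.ae_eq
    _ ≤ ∫⁻ ξ, ∑' i, ‖F i ξ‖ₑ := lintegral_mono fun ξ => enorm_tsum_le_tsum_enorm
    _ = ∑' i, l1norm (F i) := lintegral_tsum fun i => (h.measurable_term i).enorm.aemeasurable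

theorem tsum_mul_tsum_ennreal {ι κ : Type*} (a : ι → ℝ≥0∞) (b : κ → ℝ≥0∞) :
    ∑' p : ι × κ, a p.1 * b p.2 = (∑' i, a i) * ∑' k, b k := by
  rw [ENNReal.tsum_prod (f := fun i k => a i * b k)]
  simp only [ENNReal.tsum_mul_left, ENNReal.tsum_mul_right]

theorem IsL1Sum.ftild {ι : Type*} {F : ι → Ed d → ℂ} {f : Ed d → ℂ} (h : IsL1Sum F f) :
    IsL1Sum (fun i => ftild (F i)) (ftild f) where
  measurable_term i := measurable_ftild (h.measurable_term i)
  tsum_ne_top := by simpa only [l1norm_ftild] using h.tsum_ne_top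
  measurable_sum := measurable_ftild h.measurable_sum
  ae_eq := by
    filter_upwards [ftild_congr (g := fun ξ => ∑' i, F i ξ) h.ae_eq] with ξ hξ
    rw [hξ]
    simp only [_root_.ftild, Complex.conj_tsum]

theorem IsL1Sum.fconv {ι κ : Type*} [Countable ι] [Countable κ] {F : ι → Ed d → ℂ}
    {G : κ → Ed d → ℂ} {f g : Ed d → ℂ} (hf : IsL1Sum F f) (hg : IsL1Sum G g) :
    IsL1Sum (fun p : ι × κ => fconv (F p.1) (G p.2)) (fconv f g) where
  measurable_term p := measurable_fconv (hf.measurable_term _) (hg.measurable_term _)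
  tsum_ne_top := by
    refine ne_top_of_le_ne_top (ENNReal.mul_ne_top hf.tsum_ne_top hg.tsum_ne_top) ?_
    rw [← tsum_mul_tsum_ennreal]
    exact ENNReal.tsum_le_tsum fun p =>
      l1norm_fconv_le (hf.measurable_term _) (hg.measurable_term _)
  measurable_sum := measurable_fconv hf.measurable_sum hg.measurable_sum
  ae_eq := by
    have hm : ∀ (p : ι × κ) (ξ : Ed d), Measurable fun η => F p.1 η * G p.2 (ξ - η) :=
      fun p ξ => (hf.measurable_term _).mul
        ((hg.measurable_term _).comp (measurable_id.const_sub ξ))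
    have hm2 : ∀ p : ι × κ, Measurable fun ξ => ∫⁻ η, ‖F p.1 η * G p.2 (ξ - η)‖ₑ := by
      intro p
      exact Measurable.lintegral_prod_right'
        (f := fun q : Ed d × Ed d => ‖F p.1 q.2 * G p.2 (q.1 - q.2)‖ₑ)
        (((hf.measurable_term _).comp measurable_snd).mul
          ((hg.measurable_term _).comp (measurable_fst.sub measurable_snd))).enorm
    have hfin : ∫⁻ ξ, ∑' p : ι × κ, ∫⁻ η, ‖F p.1 η * G p.2 (ξ - η)‖ₑ ≠ ⊤ := by
      rw [lintegral_tsum fun p => (hm2 p).aemeasurable]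
      simp only [lintegral_lintegral_mul_sub (hf.measurable_term _) (hg.measurable_term _)]
      rw [tsum_mul_tsum_ennreal (fun i => l1norm (F i)) fun k => l1norm (G k)]
      exact ENNReal.mul_ne_top hf.tsum_ne_top hg.tsum_ne_top
    filter_upwards [ae_lt_top (Measurable.tsum hm2) hfin] with ξ hξ
    have hqg := (quasiMeasurePreserving_sub_left_of_right_invariant
      (volume : Measure (Ed d)) ξ).ae (hg.ae_eq.and hg.ae_summable)
    change _ = ∑' p : ι × κ, ∫ η, F p.1 η * G p.2 (ξ - η)
    rw [← integral_tsum (fun p => (hm p ξ).aestronglyMeasurable) hξ.ne]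
    refine integral_congr_ae ?_
    filter_upwards [hf.ae_eq, hf.ae_summable, hqg] with η h1 h2 h3
    rw [h1, h3.1]
    exact tsum_mul_tsum_of_summable_norm h2 h3.2

theorem ae_fconv_integrable {f g : Ed d → ℂ} (hf : Measurable f) (hg : Measurable g)
    (hf' : l1norm f ≠ ⊤) (hg' : l1norm g ≠ ⊤) :
    ∀ᵐ ξ : Ed d, Integrable fun η => f η * g (ξ - η) := by
  have hm : Measurable fun q : Ed d × Ed d => f q.2 * g (q.1 - q.2) :=
    (hf.comp measurable_snd).mul (hg.comp (measurable_fst.sub measurable_snd))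
  have h : ∫⁻ ξ, ∫⁻ η, ‖f η * g (ξ - η)‖ₑ ≠ ⊤ := by
    rw [lintegral_lintegral_mul_sub hf hg]
    exact ENNReal.mul_ne_top hf' hg'
  filter_upwards [ae_lt_top (Measurable.lintegral_prod_right'
    (f := fun q : Ed d × Ed d => ‖f q.2 * g (q.1 - q.2)‖ₑ) hm.enorm) h] with ξ hξ
  exact ⟨(hm.comp measurable_prodMk_left).aestronglyMeasurable, hξ⟩

theorem l1norm_fconv_sub_le {f f' g g' : Ed d → ℂ} (hf : Measurable f) (hf' : Measurable f')
    (hg : Measurable g) (hg' : Measurable g') (nf : l1norm f ≠ ⊤) (nf' : l1norm f' ≠ ⊤)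
    (ng : l1norm g ≠ ⊤) (ng' : l1norm g' ≠ ⊤) :
    l1norm (fconv f g - fconv f' g') ≤
      l1norm (f - f') * l1norm g + l1norm f' * l1norm (g - g') := by
  have h : fconv f g - fconv f' g' =ᵐ[volume] fconv (f - f') g + fconv f' (g - g') := by
    filter_upwards [ae_fconv_integrable hf hg nf ng, ae_fconv_integrable hf' hg nf' ng,
      ae_fconv_integrable hf' hg' nf' ng'] with ξ h1 h2 h3
    simp only [fconv, Pi.sub_apply, Pi.add_apply, sub_mul, mul_sub]
    rw [integral_sub h1 h2, integral_sub h2 h3]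
    ring
  rw [l1norm_congr h]
  calc l1norm (fconv (f - f') g + fconv f' (g - g'))
      ≤ l1norm (fconv (f - f') g) + l1norm (fconv f' (g - g')) := by
        unfold l1norm
        rw [← lintegral_add_left (measurable_fconv (hf.sub hf') hg).enorm]
        exact lintegral_mono fun ξ => enorm_add_le _ _
    _ ≤ _ := add_le_add (l1norm_fconv_le (hf.sub hf') hg) (l1norm_fconv_le hf' (hg.sub hg'))

/-- The frequency-side quintic form `f₁ ⋆ f̃₂ ⋆ f₃ ⋆ f̃₄ ⋆ f₅`. -/
def quint (f₁ f₂ f₃ f₄ f₅ : Ed d → ℂ) : Ed d → ℂ :=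
  fconv (fconv (fconv (fconv f₁ (ftild f₂)) f₃) (ftild f₄)) f₅

theorem quint_congr {f g : Ed d → ℂ} (h : f =ᵐ[volume] g) :
    quint f f f f f = quint g g g g g := by
  unfold quint
  rw [fconv_congr h (ftild_congr h), fconv_congr (ae_eq_refl _) h,
    fconv_congr (ae_eq_refl _) (ftild_congr h), fconv_congr (ae_eq_refl _) h]

theorem measurable_quint_uncurry {X : Type*} [MeasurableSpace X] {F₁ F₂ F₃ F₄ F₅ : X → Ed d → ℂ}
    (h₁ : Measurable (Function.uncurry F₁)) (h₂ : Measurable (Function.uncurry F₂))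
    (h₃ : Measurable (Function.uncurry F₃)) (h₄ : Measurable (Function.uncurry F₄))
    (h₅ : Measurable (Function.uncurry F₅)) :
    Measurable (Function.uncurry fun x => quint (F₁ x) (F₂ x) (F₃ x) (F₄ x) (F₅ x)) :=
  measurable_fconv_uncurry (measurable_fconv_uncurry (measurable_fconv_uncurry
    (measurable_fconv_uncurry h₁ (measurable_ftild_uncurry h₂)) h₃)
    (measurable_ftild_uncurry h₄)) h₅

theorem l1norm_quint_le {f₁ f₂ f₃ f₄ f₅ : Ed d → ℂ} (h₁ : Measurable f₁) (h₂ : Measurable f₂)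
    (h₃ : Measurable f₃) (h₄ : Measurable f₄) (h₅ : Measurable f₅) :
    l1norm (quint f₁ f₂ f₃ f₄ f₅) ≤
      l1norm f₁ * l1norm f₂ * l1norm f₃ * l1norm f₄ * l1norm f₅ := by
  have m₂ := measurable_fconv h₁ (measurable_ftild h₂)
  have m₃ := measurable_fconv m₂ h₃
  have m₄ := measurable_fconv m₃ (measurable_ftild h₄)
  refine (l1norm_fconv_le m₄ h₅).trans (mul_le_mul_left ?_ _)
  refine (l1norm_fconv_le m₃ (measurable_ftild h₄)).trans ?_
  rw [l1norm_ftild]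
  refine mul_le_mul_left ?_ _
  refine (l1norm_fconv_le m₂ h₃).trans (mul_le_mul_left ?_ _)
  exact (l1norm_fconv_le h₁ (measurable_ftild h₂)).trans (by rw [l1norm_ftild])

theorem IsL1Sum.quint {ι : Type*} [Countable ι] {F : ι → Ed d → ℂ} {f : Ed d → ℂ}
    (h : IsL1Sum F f) :
    IsL1Sum (fun p : (((ι × ι) × ι) × ι) × ι =>
      quint (F p.1.1.1.1) (F p.1.1.1.2) (F p.1.1.2) (F p.1.2) (F p.2)) (quint f f f f f) :=
  (((h.fconv h.ftild).fconv h).fconv h.ftild).fconv h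

theorem l1norm_ftild_sub (f g : Ed d → ℂ) : l1norm (ftild f - ftild g) = l1norm (f - g) := by
  rw [← l1norm_ftild (f - g)]
  congr 1
  funext ξ
  simp [ftild]

theorem l1norm_quint_sub_le {f g : Ed d → ℂ} {M : ℝ≥0∞} (hf : Measurable f) (hg : Measurable g)
    (hM : M ≠ ⊤) (nf : l1norm f ≤ M) (ng : l1norm g ≤ M) :
    l1norm (quint f f f f f - quint g g g g g) ≤ 5 * M ^ 4 * l1norm (f - g) := by
  have step : ∀ {a a' b b' : Ed d → ℂ} {k : ℕ}, Measurable a → Measurable a' → Measurable b →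
      Measurable b' → l1norm a ≤ M ^ (k + 1) → l1norm a' ≤ M ^ (k + 1) → l1norm b ≤ M →
      l1norm b' ≤ M → l1norm (b - b') = l1norm (f - g) →
      l1norm (a - a') ≤ ((k + 1 : ℕ) : ℝ≥0∞) * M ^ k * l1norm (f - g) →
      l1norm (fconv a b) ≤ M ^ (k + 1 + 1) ∧ l1norm (fconv a' b') ≤ M ^ (k + 1 + 1) ∧
      l1norm (fconv a b - fconv a' b') ≤
        ((k + 1 + 1 : ℕ) : ℝ≥0∞) * M ^ (k + 1) * l1norm (f - g) := by
    intro a a' b b' k ma ma' mb mb' na na' nb nb' eb ea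
    have hk : M ^ (k + 1) ≠ ⊤ := ENNReal.pow_ne_top hM
    refine ⟨?_, ?_, ?_⟩
    · rw [pow_succ]
      exact (l1norm_fconv_le ma mb).trans (mul_le_mul' na nb)
    · rw [pow_succ]
      exact (l1norm_fconv_le ma' mb').trans (mul_le_mul' na' nb')
    · refine (l1norm_fconv_sub_le ma ma' mb mb' (ne_top_of_le_ne_top hk na)
        (ne_top_of_le_ne_top hk na') (ne_top_of_le_ne_top hM nb)
        (ne_top_of_le_ne_top hM nb')).trans ?_
      rw [eb]
      refine (add_le_add (mul_le_mul' ea nb) (mul_le_mul' na' le_rfl)).trans (le_of_eq ?_)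
      push_cast
      ring
  have tf := measurable_ftild hf
  have tg := measurable_ftild hg
  have ntf : l1norm (ftild f) ≤ M := by rwa [l1norm_ftild]
  have ntg : l1norm (ftild g) ≤ M := by rwa [l1norm_ftild]
  obtain ⟨p₁, p₂, p₃⟩ := step (k := 0) hf hg tf tg (by simpa using nf) (by simpa using ng) ntf ntg
    (l1norm_ftild_sub f g) (by simp)
  have m₁ := measurable_fconv hf tf
  have m₁' := measurable_fconv hg tg
  obtain ⟨q₁, q₂, q₃⟩ := step m₁ m₁' hf hg p₁ p₂ nf ng rfl p₃
  have m₂ := measurable_fconv m₁ hf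
  have m₂' := measurable_fconv m₁' hg
  obtain ⟨r₁, r₂, r₃⟩ := step m₂ m₂' tf tg q₁ q₂ ntf ntg (l1norm_ftild_sub f g) q₃
  have m₃ := measurable_fconv m₂ tf
  have m₃' := measurable_fconv m₂' tg
  obtain ⟨-, -, s₃⟩ := step m₃ m₃' hf hg r₁ r₂ nf ng rfl r₃
  exact s₃.trans_eq (by norm_num)

end ConvolutionL1

section Duhamel

variable {d : ℕ}

/-- The Duhamel operator of the linear flow `e^{it|ξ|⁴}` on the Fourier side. -/
def duhamel (μ : ℝ) (H : ℝ → Ed d → ℂ) (t : ℝ) (ξ : Ed d) : ℂ :=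
  Complex.I * (μ : ℂ) * Complex.exp (Complex.I * ((t : ℂ) * (‖ξ‖ : ℂ) ^ 4)) *
    ∫ τ in (0:ℝ)..t, Complex.exp (-(Complex.I * ((τ : ℂ) * (‖ξ‖ : ℂ) ^ 4))) * H τ ξ

theorem enorm_phase (t : ℝ) (ξ : Ed d) :
    ‖Complex.exp (Complex.I * ((t : ℂ) * (‖ξ‖ : ℂ) ^ 4))‖ₑ = 1 := by
  have : ‖Complex.exp (Complex.I * ((t : ℂ) * (‖ξ‖ : ℂ) ^ 4))‖ = 1 := by
    rw [mul_comm]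
    exact_mod_cast Complex.norm_exp_ofReal_mul_I (t * ‖ξ‖ ^ (4 : ℕ))
  rw [← ofReal_norm, this, ENNReal.ofReal_one]

theorem enorm_phase_neg (t : ℝ) (ξ : Ed d) :
    ‖Complex.exp (-(Complex.I * ((t : ℂ) * (‖ξ‖ : ℂ) ^ 4)))‖ₑ = 1 := by
  have := enorm_phase (-t) ξ
  rwa [show Complex.I * (((-t : ℝ) : ℂ) * (‖ξ‖ : ℂ) ^ 4) =
    -(Complex.I * ((t : ℂ) * (‖ξ‖ : ℂ) ^ 4)) by push_cast; ring] at this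

theorem continuous_phase :
    Continuous fun p : ℝ × Ed d => Complex.exp (Complex.I * ((p.1 : ℂ) * (‖p.2‖ : ℂ) ^ 4)) := by
  fun_prop

theorem continuous_phase_neg :
    Continuous fun p : ℝ × Ed d =>
      Complex.exp (-(Complex.I * ((p.1 : ℂ) * (‖p.2‖ : ℂ) ^ 4))) := by
  fun_prop

theorem measurable_backward {H : ℝ → Ed d → ℂ} (hH : Measurable (Function.uncurry H)) :
    Measurable fun p : ℝ × Ed d =>
      Complex.exp (-(Complex.I * ((p.1 : ℂ) * (‖p.2‖ : ℂ) ^ 4))) * H p.1 p.2 :=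
  continuous_phase_neg.measurable.mul hH

theorem measurable_duhamel (μ : ℝ) {H : ℝ → Ed d → ℂ} (hH : Measurable (Function.uncurry H)) :
    Measurable (Function.uncurry (duhamel μ H)) := by
  have key : ∀ s : Set (ℝ × ℝ), MeasurableSet s → Measurable fun p : ℝ × Ed d =>
      ∫ τ, {τ | (p.1, τ) ∈ s}.indicator
        (fun τ => Complex.exp (-(Complex.I * ((τ : ℂ) * (‖p.2‖ : ℂ) ^ 4))) * H τ p.2) τ := by
    intro s hs
    have hm : Measurable (fun q : (ℝ × Ed d) × ℝ =>
        ((fun q : (ℝ × Ed d) × ℝ => (q.1.1, q.2)) ⁻¹' s).indicator (fun q =>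
          Complex.exp (-(Complex.I * ((q.2 : ℂ) * (‖q.1.2‖ : ℂ) ^ 4))) * H q.2 q.1.2) q) :=
      ((measurable_backward hH).comp (measurable_snd.prodMk measurable_fst.snd)).indicator
        ((measurable_fst.fst.prodMk measurable_snd) hs)
    exact (StronglyMeasurable.integral_prod_right (ν := (volume : Measure ℝ))
      (f := fun (p : ℝ × Ed d) τ => {τ | (p.1, τ) ∈ s}.indicator
        (fun τ => Complex.exp (-(Complex.I * ((τ : ℂ) * (‖p.2‖ : ℂ) ^ 4))) * H τ p.2) τ)
      hm.stronglyMeasurable).measurable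
  have h1 := key {p | 0 < p.2 ∧ p.2 ≤ p.1}
    ((measurableSet_lt measurable_const measurable_snd).inter
      (measurableSet_le measurable_snd measurable_fst))
  have h2 := key {p | p.1 < p.2 ∧ p.2 ≤ 0}
    ((measurableSet_lt measurable_fst measurable_snd).inter
      (measurableSet_le measurable_snd measurable_const))
  have h3 := (continuous_phase.measurable.const_mul (Complex.I * (μ : ℂ))).mul (h1.sub h2)
  convert h3 using 1
  funext ⟨t, ξ⟩
  simp only [Function.uncurry_apply_pair, duhamel, intervalIntegral, Pi.mul_apply, Pi.sub_apply]
  rw [← integral_indicator measurableSet_Ioc, ← integral_indicator measurableSet_Ioc]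
  rfl

theorem enorm_duhamel_le {μ : ℝ} (hμ : ‖(μ : ℂ)‖ₑ = 1) (H : ℝ → Ed d → ℂ) {t : ℝ} (ht : 0 ≤ t)
    (ξ : Ed d) : ‖duhamel μ H t ξ‖ₑ ≤ ∫⁻ τ in Ioc 0 t, ‖H τ ξ‖ₑ := by
  rw [duhamel, enorm_mul, enorm_mul, enorm_mul, hμ, enorm_phase,
    intervalIntegral.integral_of_le ht]
  have hI : ‖Complex.I‖ₑ = 1 := by rw [← ofReal_norm, Complex.norm_I, ENNReal.ofReal_one]
  rw [hI, one_mul, one_mul, one_mul]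
  refine (enorm_integral_le_lintegral_enorm _).trans (le_of_eq ?_)
  simp only [enorm_mul, enorm_phase_neg, one_mul]

theorem lintegral_lintegral_Ioc {H : ℝ → Ed d → ℂ} (hH : Measurable (Function.uncurry H)) (t : ℝ) :
    ∫⁻ ξ, ∫⁻ τ in Ioc 0 t, ‖H τ ξ‖ₑ = ∫⁻ τ in Ioc 0 t, l1norm (H τ) := by
  rw [lintegral_lintegral_swap]
  · rfl
  · exact (hH.comp measurable_swap).enorm.aemeasurable

theorem measurable_lintegral_Ioc {H : ℝ → Ed d → ℂ} (hH : Measurable (Function.uncurry H))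
    (t : ℝ) : Measurable fun ξ => ∫⁻ τ in Ioc 0 t, ‖H τ ξ‖ₑ :=
  Measurable.lintegral_prod_right' (f := fun p : Ed d × ℝ => ‖H p.2 p.1‖ₑ)
    (hH.comp measurable_swap).enorm

theorem l1norm_duhamel_le {μ : ℝ} (hμ : ‖(μ : ℂ)‖ₑ = 1) {H : ℝ → Ed d → ℂ}
    (hH : Measurable (Function.uncurry H)) {t : ℝ} (ht : 0 ≤ t) :
    l1norm (duhamel μ H t) ≤ ∫⁻ τ in Ioc 0 t, l1norm (H τ) := by
  rw [← lintegral_lintegral_Ioc hH]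
  exact lintegral_mono fun ξ => enorm_duhamel_le hμ H ht ξ

theorem ae_integrableOn_backward {H : ℝ → Ed d → ℂ} (hH : Measurable (Function.uncurry H)) {t : ℝ}
    (hfin : ∫⁻ τ in Ioc 0 t, l1norm (H τ) ≠ ⊤) :
    ∀ᵐ ξ : Ed d, IntegrableOn (fun τ : ℝ =>
      Complex.exp (-(Complex.I * ((τ : ℂ) * (‖ξ‖ : ℂ) ^ 4))) * H τ ξ) (Ioc 0 t) := by
  rw [← lintegral_lintegral_Ioc hH] at hfin
  filter_upwards [ae_lt_top (measurable_lintegral_Ioc hH t) hfin] with ξ hξ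
  refine ⟨((measurable_backward hH).comp measurable_prodMk_right).aestronglyMeasurable, ?_⟩
  simpa only [HasFiniteIntegral, enorm_mul, enorm_phase_neg, one_mul] using hξ

theorem duhamel_sub_ae {μ : ℝ} {H K : ℝ → Ed d → ℂ}
    (hH : Measurable (Function.uncurry H)) (hK : Measurable (Function.uncurry K)) {t : ℝ}
    (ht : 0 ≤ t) (hHf : ∫⁻ τ in Ioc 0 t, l1norm (H τ) ≠ ⊤)
    (hKf : ∫⁻ τ in Ioc 0 t, l1norm (K τ) ≠ ⊤) :
    duhamel μ H t - duhamel μ K t =ᵐ[volume] duhamel μ (fun τ => H τ - K τ) t := by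
  filter_upwards [ae_integrableOn_backward hH hHf, ae_integrableOn_backward hK hKf] with ξ h1 h2
  simp only [Pi.sub_apply, duhamel, intervalIntegral.integral_of_le ht]
  rw [← mul_sub, ← integral_sub h1 h2]
  simp only [mul_sub]

theorem duhamel_tsum_ae {ι : Type*} [Countable ι] (μ : ℝ) {H : ι → ℝ → Ed d → ℂ}
    {h : ℝ → Ed d → ℂ} (hH : ∀ i, Measurable (Function.uncurry (H i)))
    (hh : Measurable (Function.uncurry h)) {t : ℝ} (ht : 0 ≤ t)
    (hs : ∀ τ ∈ Ioc 0 t, IsL1Sum (fun i => H i τ) (h τ))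
    (hfin : ∑' i, ∫⁻ τ in Ioc 0 t, l1norm (H i τ) ≠ ⊤) :
    ∀ᵐ ξ : Ed d, duhamel μ h t ξ = ∑' i, duhamel μ (H i) t ξ := by
  have hsw : ∀ᵐ ξ : Ed d, ∀ᵐ τ ∂(volume.restrict (Ioc 0 t)), h τ ξ = ∑' i, H i τ ξ := by
    have hms : MeasurableSet {p : ℝ × Ed d | h p.1 p.2 = ∑' i, H i p.1 p.2} :=
      measurableSet_eq_fun hh (Measurable.tsum hH)
    rw [← Measure.ae_ae_comm (p := fun τ ξ => h τ ξ = ∑' i, H i τ ξ) hms]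
    exact (ae_restrict_iff' measurableSet_Ioc).2 (Eventually.of_forall fun τ hτ => (hs τ hτ).ae_eq)
  have hfin' : ∫⁻ ξ, ∑' i, ∫⁻ τ in Ioc 0 t, ‖H i τ ξ‖ₑ ≠ ⊤ := by
    rw [lintegral_tsum fun i => (measurable_lintegral_Ioc (hH i) t).aemeasurable]
    simpa only [lintegral_lintegral_Ioc (hH _)] using hfin
  filter_upwards [hsw, ae_lt_top (Measurable.tsum fun i => measurable_lintegral_Ioc (hH i) t) hfin']
    with ξ h1 h2
  simp only [duhamel, intervalIntegral.integral_of_le ht]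
  rw [tsum_mul_left]
  congr 1
  rw [← integral_tsum]
  · refine integral_congr_ae ?_
    filter_upwards [h1] with τ hτ
    rw [hτ, tsum_mul_left]
  · exact fun i => ((measurable_backward (hH i)).comp measurable_prodMk_right).aestronglyMeasurable
  · simpa only [enorm_mul, enorm_phase_neg, one_mul] using h2.ne

theorem tendsto_l1norm_flow_add_duhamel {μ : ℝ} (hμ : ‖(μ : ℂ)‖ₑ = 1) {g : Ed d → ℂ}
    (hg : Measurable g) (hgf : l1norm g ≠ ⊤) {H : ℝ → Ed d → ℂ}
    (hH : Measurable (Function.uncurry H)) {T : ℝ} (hfin : ∫⁻ τ in Ioc 0 T, l1norm (H τ) ≠ ⊤)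
    {t₀ : ℝ} (ht₀ : t₀ ∈ Icc 0 T) :
    Tendsto (fun t : ℝ => l1norm fun ξ =>
      (Complex.exp (Complex.I * ((t : ℂ) * (‖ξ‖ : ℂ) ^ 4)) * g ξ + duhamel μ H t ξ) -
      (Complex.exp (Complex.I * ((t₀ : ℂ) * (‖ξ‖ : ℂ) ^ 4)) * g ξ + duhamel μ H t₀ ξ))
      (𝓝[Icc 0 T] t₀) (𝓝 0) := by
  set u : ℝ → Ed d → ℂ := fun t ξ =>
    Complex.exp (Complex.I * ((t : ℂ) * (‖ξ‖ : ℂ) ^ 4)) * g ξ + duhamel μ H t ξ with hu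
  have hmu : ∀ t, Measurable (u t) := fun t =>
    ((continuous_phase.measurable.comp measurable_prodMk_left).mul hg).add
      (measurable_slice (measurable_duhamel μ hH) t)
  set b : Ed d → ℝ≥0∞ := fun ξ => ‖g ξ‖ₑ + ∫⁻ τ in Ioc 0 T, ‖H τ ξ‖ₑ with hb
  have hbound : ∀ t ∈ Icc 0 T, ∀ ξ, ‖u t ξ‖ₑ ≤ b ξ := by
    intro t ht ξ
    refine (enorm_add_le _ _).trans (add_le_add ?_ ?_)
    · rw [enorm_mul, enorm_phase, one_mul]
    · exact (enorm_duhamel_le hμ H ht.1 ξ).trans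
        (lintegral_mono_set (Ioc_subset_Ioc_right ht.2))
  have hbf : ∫⁻ ξ, (b ξ + b ξ) ≠ ⊤ := by
    have hmb : Measurable b := hg.enorm.add (measurable_lintegral_Ioc hH T)
    have : ∫⁻ ξ, b ξ ≠ ⊤ := by
      simp only [hb]
      rw [lintegral_add_left hg.enorm, lintegral_lintegral_Ioc hH]
      exact ENNReal.add_ne_top.2 ⟨hgf, hfin⟩
    rw [lintegral_add_left hmb]
    exact ENNReal.add_ne_top.2 ⟨this, this⟩
  have hlim := tendsto_lintegral_filter_of_dominated_convergence (μ := (volume : Measure (Ed d)))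
    (l := 𝓝[Icc 0 T] t₀) (F := fun t ξ => ‖u t ξ - u t₀ ξ‖ₑ) (f := fun _ => 0)
    (fun ξ => b ξ + b ξ)
    (Eventually.of_forall fun t => ((hmu t).sub (hmu t₀)).enorm)
    (eventually_mem_nhdsWithin.mono fun t ht => Eventually.of_forall fun ξ =>
      (enorm_sub_le).trans (add_le_add (hbound t ht ξ) (hbound t₀ ht₀ ξ))) hbf ?_
  · rw [lintegral_zero] at hlim
    exact hlim
  filter_upwards [ae_integrableOn_backward hH hfin] with ξ hξ
  have hc : ContinuousOn (fun t => u t ξ) (Icc 0 T) := by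
    refine ContinuousOn.add ?_ ?_
    · exact (by fun_prop : Continuous fun t : ℝ =>
        Complex.exp (Complex.I * ((t : ℂ) * (‖ξ‖ : ℂ) ^ 4)) * g ξ).continuousOn
    · refine ContinuousOn.mul (by fun_prop) ?_
      have hI := uIcc_of_le (ht₀.1.trans ht₀.2)
      have hξ' := integrableOn_Icc_iff_integrableOn_Ioc (by simp) |>.2 hξ
      rw [← hI] at hξ'
      have h := intervalIntegral.continuousOn_primitive_interval hξ'
      rwa [hI] at h
  have h : Tendsto (fun t => ‖u t ξ - u t₀ ξ‖ₑ) (𝓝[Icc 0 T] t₀) (𝓝 ‖u t₀ ξ - u t₀ ξ‖ₑ) :=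
    ((hc t₀ ht₀).sub continuousWithinAt_const).enorm
  simpa using h

end Duhamel

section Trees

/-- A tree is a leaf or an ordered 5-tuple of trees. -/
def treeEquiv : Unit ⊕ (((Tree5 × Tree5) × Tree5) × Tree5) × Tree5 ≃ Tree5 where
  toFun
    | .inl _ => .leaf
    | .inr p => .node p.1.1.1.1 p.1.1.1.2 p.1.1.2 p.1.2 p.2
  invFun
    | .leaf => .inl ()
    | .node a b c d e => .inr ((((a, b), c), d), e)
  left_inv x := by rcases x with _ | ⟨⟨⟨⟨a, b⟩, c⟩, d⟩, e⟩ <;> rfl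
  right_inv x := by cases x <;> rfl

/-- The height of a tree. -/
def Tree5.height : Tree5 → ℕ
  | .leaf => 0
  | .node a b c d e => max (max (max (max a.height b.height) c.height) d.height) e.height + 1

instance : Countable Tree5 := by
  have hfin : ∀ n, {T : Tree5 | T.height ≤ n}.Countable := by
    intro n
    induction n with
    | zero =>
      refine (countable_singleton Tree5.leaf).mono fun T hT => ?_
      cases T with
      | leaf => rfl
      | node => simp [Tree5.height] at hT
    | succ n ih =>
      have hp := (((ih.prod ih).prod ih).prod ih).prod ih
      refine ((countable_singleton Tree5.leaf).union
        (hp.image fun p => treeEquiv (.inr p))).mono fun T hT => ?_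
      cases T with
      | leaf => exact Or.inl rfl
      | node a b c d e =>
        refine Or.inr ⟨((((a, b), c), d), e), ?_, rfl⟩
        simpa [Tree5.height, and_assoc] using hT
  refine countable_univ_iff.1 ((countable_iUnion hfin).mono fun T _ => ?_)
  exact mem_iUnion.2 ⟨T.height, le_refl T.height⟩

theorem tsum_tree_ennreal (w : Tree5 → ℝ≥0∞) :
    ∑' T, w T = w .leaf + ∑' p : (((Tree5 × Tree5) × Tree5) × Tree5) × Tree5,
      w (.node p.1.1.1.1 p.1.1.1.2 p.1.1.2 p.1.2 p.2) := by
  rw [← treeEquiv.tsum_eq w, ENNReal.summable.tsum_sum ENNReal.summable]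
  simp only [tsum_fintype, Finset.univ_unique, Finset.sum_singleton]
  rfl

theorem tsum_quint_ennreal (w : Tree5 → ℝ≥0∞) :
    ∑' p : (((Tree5 × Tree5) × Tree5) × Tree5) × Tree5,
      w p.1.1.1.1 * w p.1.1.1.2 * w p.1.1.2 * w p.1.2 * w p.2 = (∑' T, w T) ^ 5 := by
  rw [tsum_mul_tsum_ennreal
      (fun q : ((Tree5 × Tree5) × Tree5) × Tree5 => w q.1.1.1 * w q.1.1.2 * w q.1.2 * w q.2) w,
    tsum_mul_tsum_ennreal (fun q : (Tree5 × Tree5) × Tree5 => w q.1.1 * w q.1.2 * w q.2) w,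
    tsum_mul_tsum_ennreal (fun q : Tree5 × Tree5 => w q.1 * w q.2) w, tsum_mul_tsum_ennreal w w]
  ring

theorem tsum_pow_internal_le {a : ℝ≥0∞} (ha : a * 32 ≤ 1) :
    ∑' T : Tree5, a ^ T.internal ≤ 2 := by
  let w : ℕ → Tree5 → ℝ≥0∞ := fun n T => if T.height < n then a ^ T.internal else 0
  have hw : ∀ n, ∑' T, w n T ≤ 2 := by
    intro n
    induction n with
    | zero => simp [w]
    | succ n ih =>
      rw [tsum_tree_ennreal]
      have h1 : w (n + 1) .leaf ≤ 1 := by simp [w, Tree5.height, Tree5.internal]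
      have h2 : ∀ p : (((Tree5 × Tree5) × Tree5) × Tree5) × Tree5,
          w (n + 1) (.node p.1.1.1.1 p.1.1.1.2 p.1.1.2 p.1.2 p.2) ≤
            a * (w n p.1.1.1.1 * w n p.1.1.1.2 * w n p.1.1.2 * w n p.1.2 * w n p.2) := by
        rintro ⟨⟨⟨⟨t₁, t₂⟩, t₃⟩, t₄⟩, t₅⟩
        by_cases h : (Tree5.node t₁ t₂ t₃ t₄ t₅).height < n + 1
        · have h' := h
          simp only [Tree5.height, add_lt_add_iff_right, max_lt_iff] at h'
          obtain ⟨⟨⟨⟨h₁, h₂⟩, h₃⟩, h₄⟩, h₅⟩ := h'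
          simp only [w, if_pos h, if_pos h₁, if_pos h₂, if_pos h₃, if_pos h₄, if_pos h₅,
            Tree5.internal]
          exact le_of_eq (by ring)
        · simp only [w, if_neg h]
          exact zero_le
      calc w (n + 1) .leaf + ∑' p : (((Tree5 × Tree5) × Tree5) × Tree5) × Tree5,
            w (n + 1) (.node p.1.1.1.1 p.1.1.1.2 p.1.1.2 p.1.2 p.2)
          ≤ 1 + a * (∑' T, w n T) ^ 5 := by
            refine add_le_add h1 ((ENNReal.tsum_le_tsum h2).trans ?_)
            rw [ENNReal.tsum_mul_left, tsum_quint_ennreal]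
        _ ≤ 1 + a * 2 ^ 5 := by gcongr
        _ ≤ 1 + 1 := by
            gcongr
            exact le_of_eq_of_le (by norm_num) ha
        _ = 2 := one_add_one_eq_two
  rw [ENNReal.tsum_eq_iSup_sum]
  refine iSup_le fun s => ?_
  refine le_trans ?_ ((ENNReal.sum_le_tsum s).trans (hw (s.sup Tree5.height + 1)))
  refine Finset.sum_le_sum fun T hT => ?_
  simp [w, Nat.lt_succ_of_le (Finset.le_sup (f := Tree5.height) hT)]

variable {d : ℕ} {μ : ℝ}

theorem FPsi_node (g : Ed d → ℂ) (a b c e f : Tree5) :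
    FPsi d μ g (.node a b c e f) = duhamel μ fun τ =>
      quint (FPsi d μ g a τ) (FPsi d μ g b τ) (FPsi d μ g c τ) (FPsi d μ g e τ)
        (FPsi d μ g f τ) := rfl

theorem measurable_FPsi {g : Ed d → ℂ} (hg : Measurable g) (T : Tree5) :
    Measurable (Function.uncurry (FPsi d μ g T)) := by
  induction T with
  | leaf => exact continuous_phase.measurable.mul (hg.comp measurable_snd)
  | node a b c e f ha hb hc he hf =>
    rw [FPsi_node]
    exact measurable_duhamel μ (measurable_quint_uncurry ha hb hc he hf)

theorem FPsi_congr {g g' : Ed d → ℂ} (h : g =ᵐ[volume] g') (T : Tree5) (t : ℝ) :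
    FPsi d μ g T t =ᵐ[volume] FPsi d μ g' T t := by
  induction T generalizing t with
  | leaf =>
    filter_upwards [h] with ξ hξ
    simp only [FPsi, hξ]
  | node a b c e f ha hb hc he hf =>
    refine Eq.eventuallyEq ?_
    rw [FPsi_node, FPsi_node]
    congr 1
    funext τ
    unfold quint
    rw [fconv_congr (ha τ) (ftild_congr (hb τ)), fconv_congr (ae_eq_refl _) (hc τ),
      fconv_congr (ae_eq_refl _) (ftild_congr (he τ)), fconv_congr (ae_eq_refl _) (hf τ)]

theorem l1norm_FPsi_le (hμ : ‖(μ : ℂ)‖ₑ = 1) {g : Ed d → ℂ} (hg : Measurable g) {T₀ : ℝ}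
    (T : Tree5) {t : ℝ} (ht : t ∈ Icc 0 T₀) :
    l1norm (FPsi d μ g T t) ≤
      l1norm g * (ENNReal.ofReal T₀ * l1norm g ^ 4) ^ T.internal := by
  induction T generalizing t with
  | leaf =>
    simp only [l1norm, FPsi, enorm_mul, enorm_phase, one_mul, Tree5.internal, pow_zero, mul_one,
      le_refl]
  | node a b c e f ha hb hc he hf =>
    rw [FPsi_node]
    have m := fun T => measurable_FPsi (μ := μ) hg T
    refine (l1norm_duhamel_le hμ (measurable_quint_uncurry (m a) (m b) (m c) (m e) (m f))
      ht.1).trans ?_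
    set A := ENNReal.ofReal T₀ * l1norm g ^ 4 with hA
    have hle : ∀ τ ∈ Ioc 0 t, l1norm (quint (FPsi d μ g a τ) (FPsi d μ g b τ) (FPsi d μ g c τ)
        (FPsi d μ g e τ) (FPsi d μ g f τ)) ≤
        l1norm g * A ^ a.internal * (l1norm g * A ^ b.internal) * (l1norm g * A ^ c.internal) *
        (l1norm g * A ^ e.internal) * (l1norm g * A ^ f.internal) := by
      intro τ hτ
      have hτ' : τ ∈ Icc 0 T₀ := ⟨hτ.1.le, hτ.2.trans ht.2⟩
      refine (l1norm_quint_le (measurable_slice (m a) τ) (measurable_slice (m b) τ)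
        (measurable_slice (m c) τ) (measurable_slice (m e) τ) (measurable_slice (m f) τ)).trans ?_
      gcongr
      exacts [ha hτ', hb hτ', hc hτ', he hτ', hf hτ']
    refine (setLIntegral_mono' measurableSet_Ioc hle).trans ?_
    rw [setLIntegral_const, Real.volume_Ioc, sub_zero]
    calc _ ≤ l1norm g * A ^ a.internal * (l1norm g * A ^ b.internal) *
          (l1norm g * A ^ c.internal) * (l1norm g * A ^ e.internal) *
          (l1norm g * A ^ f.internal) * ENNReal.ofReal T₀ := by
          gcongr
          exact ht.2
      _ = l1norm g * (A ^ (a.internal + b.internal + c.internal + e.internal + f.internal) *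
          (ENNReal.ofReal T₀ * l1norm g ^ 4)) := by ring
      _ = _ := by rw [← hA, ← pow_succ]; rfl

/-- The sum of the Picard series over all trees. -/
def treeSum (d : ℕ) (μ : ℝ) (g : Ed d → ℂ) (t : ℝ) (ξ : Ed d) : ℂ := ∑' T, FPsi d μ g T t ξ

theorem measurable_treeSum {g : Ed d → ℂ} (hg : Measurable g) :
    Measurable (Function.uncurry (treeSum d μ g)) :=
  Measurable.tsum fun T => measurable_FPsi hg T

theorem tsum_l1norm_FPsi_le (hμ : ‖(μ : ℂ)‖ₑ = 1) {g : Ed d → ℂ} (hg : Measurable g) {T₀ : ℝ}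
    (hT₀ : ENNReal.ofReal T₀ * l1norm g ^ 4 * 32 ≤ 1) {t : ℝ} (ht : t ∈ Icc 0 T₀) :
    ∑' T, l1norm (FPsi d μ g T t) ≤ l1norm g * 2 := by
  refine (ENNReal.tsum_le_tsum fun T => l1norm_FPsi_le hμ hg T ht).trans ?_
  rw [ENNReal.tsum_mul_left]
  gcongr
  exact tsum_pow_internal_le hT₀

theorem isL1Sum_treeSum (hμ : ‖(μ : ℂ)‖ₑ = 1) {g : Ed d → ℂ} (hg : Measurable g)
    (hgf : l1norm g ≠ ⊤) {T₀ : ℝ} (hT₀ : ENNReal.ofReal T₀ * l1norm g ^ 4 * 32 ≤ 1) {t : ℝ}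
    (ht : t ∈ Icc 0 T₀) :
    IsL1Sum (fun T => FPsi d μ g T t) (treeSum d μ g t) where
  measurable_term T := measurable_slice (measurable_FPsi hg T) t
  tsum_ne_top := ne_top_of_le_ne_top (ENNReal.mul_ne_top hgf ENNReal.ofNat_ne_top)
    (tsum_l1norm_FPsi_le hμ hg hT₀ ht)
  measurable_sum := measurable_slice (measurable_treeSum hg) t
  ae_eq := Eventually.of_forall fun _ => rfl

theorem treeSum_duhamel_ae (hμ : ‖(μ : ℂ)‖ₑ = 1) {g : Ed d → ℂ} (hg : Measurable g)
    (hgf : l1norm g ≠ ⊤) {T₀ : ℝ} (hT₀ : ENNReal.ofReal T₀ * l1norm g ^ 4 * 32 ≤ 1) {t : ℝ}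
    (ht : t ∈ Icc 0 T₀) :
    ∀ᵐ ξ : Ed d, treeSum d μ g t ξ =
      Complex.exp (Complex.I * ((t : ℂ) * (‖ξ‖ : ℂ) ^ 4)) * g ξ +
      duhamel μ (fun τ => quint (treeSum d μ g τ) (treeSum d μ g τ) (treeSum d μ g τ)
        (treeSum d μ g τ) (treeSum d μ g τ)) t ξ := by
  have m := fun T => measurable_FPsi (μ := μ) hg T
  have mS := measurable_treeSum (μ := μ) hg
  have hsum : ∀ {s : ℝ}, s ∈ Icc 0 T₀ → IsL1Sum (fun T => FPsi d μ g T s) (treeSum d μ g s) :=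
    isL1Sum_treeSum hμ hg hgf hT₀
  have hfin : ∑' p : (((Tree5 × Tree5) × Tree5) × Tree5) × Tree5, ∫⁻ τ in Ioc 0 t,
      l1norm (quint (FPsi d μ g p.1.1.1.1 τ) (FPsi d μ g p.1.1.1.2 τ) (FPsi d μ g p.1.1.2 τ)
        (FPsi d μ g p.1.2 τ) (FPsi d μ g p.2 τ)) ≠ ⊤ := by
    rw [← lintegral_tsum fun p => (measurable_l1norm (measurable_quint_uncurry (m _) (m _) (m _)
      (m _) (m _))).aemeasurable]
    refine ne_top_of_le_ne_top ?_ (setLIntegral_mono' (g := fun _ => (l1norm g * 2) ^ 5)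
      measurableSet_Ioc fun τ hτ => ?_)
    · rw [setLIntegral_const, Real.volume_Ioc]
      exact ENNReal.mul_ne_top (ENNReal.pow_ne_top (ENNReal.mul_ne_top hgf ENNReal.ofNat_ne_top))
        ENNReal.ofReal_ne_top
    · refine (ENNReal.tsum_le_tsum fun p => l1norm_quint_le (measurable_slice (m _) τ)
        (measurable_slice (m _) τ) (measurable_slice (m _) τ) (measurable_slice (m _) τ)
        (measurable_slice (m _) τ)).trans ?_
      rw [tsum_quint_ennreal fun T => l1norm (FPsi d μ g T τ)]
      gcongr
      exact tsum_l1norm_FPsi_le hμ hg hT₀ ⟨hτ.1.le, hτ.2.trans ht.2⟩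
  have hD := duhamel_tsum_ae μ
    (H := fun (p : (((Tree5 × Tree5) × Tree5) × Tree5) × Tree5) τ =>
      quint (FPsi d μ g p.1.1.1.1 τ) (FPsi d μ g p.1.1.1.2 τ) (FPsi d μ g p.1.1.2 τ)
        (FPsi d μ g p.1.2 τ) (FPsi d μ g p.2 τ))
    (h := fun τ => quint (treeSum d μ g τ) (treeSum d μ g τ) (treeSum d μ g τ)
      (treeSum d μ g τ) (treeSum d μ g τ))
    (fun p => measurable_quint_uncurry (m _) (m _) (m _) (m _) (m _))
    (measurable_quint_uncurry mS mS mS mS mS) ht.1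
    (fun τ hτ => (hsum ⟨hτ.1.le, hτ.2.trans ht.2⟩).quint) hfin
  filter_upwards [hD, (hsum ht).ae_summable] with ξ h1 h2
  have hs : Summable fun x => FPsi d μ g (treeEquiv x) t ξ := treeEquiv.summable_iff.2 h2.of_norm
  rw [h1, treeSum, ← treeEquiv.tsum_eq fun T => FPsi d μ g T t ξ,
    Summable.tsum_sum (f := fun x => FPsi d μ g (treeEquiv x) t ξ)
      (hs.comp_injective Sum.inl_injective) (hs.comp_injective Sum.inr_injective)]
  simp only [tsum_fintype, Finset.univ_unique, Finset.sum_singleton]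
  rfl

theorem FPsi_congr_all {g g' : Ed d → ℂ} (h : g =ᵐ[volume] g') (t : ℝ) :
    ∀ᵐ ξ : Ed d, ∀ T, FPsi d μ g T t ξ = FPsi d μ g' T t ξ :=
  ae_all_iff.2 fun T => FPsi_congr h T t

theorem tsum_tree_eq_tsum_internal {w : Tree5 → ℂ} (hw : Summable w) :
    ∑' T, w T = ∑' (j : ℕ) (T : {T : Tree5 // T.internal = j}), w T := by
  have hs := (Equiv.sigmaFiberEquiv Tree5.internal).summable_iff.2 hw
  exact ((Equiv.sigmaFiberEquiv Tree5.internal).tsum_eq w).symm.trans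
    (hs.tsum_sigma' fun j => hs.sigma_factor j)

theorem tsum_tree_eq_tsum_internal_ennreal (w : Tree5 → ℝ≥0∞) :
    ∑' T, w T = ∑' (j : ℕ) (T : {T : Tree5 // T.internal = j}), w T :=
  ((Equiv.sigmaFiberEquiv Tree5.internal).tsum_eq w).symm.trans (ENNReal.tsum_sigma' _)

theorem tsum_FTheta_ae_eq_treeSum (hμ : ‖(μ : ℂ)‖ₑ = 1) {g g' : Ed d → ℂ} (hg : Measurable g)
    (hgf : l1norm g ≠ ⊤) (hgg' : g' =ᵐ[volume] g) {T₀ : ℝ}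
    (hT₀ : ENNReal.ofReal T₀ * l1norm g ^ 4 * 32 ≤ 1) {t : ℝ} (ht : t ∈ Icc 0 T₀) :
    ∀ᵐ ξ : Ed d, treeSum d μ g t ξ = ∑' j : ℕ, FTheta d μ g' j t ξ := by
  filter_upwards [(isL1Sum_treeSum hμ hg hgf hT₀ ht).ae_summable,
    FPsi_congr_all (μ := μ) hgg' t] with ξ h1 h2
  rw [treeSum, tsum_tree_eq_tsum_internal h1.of_norm]
  exact tsum_congr fun j => tsum_congr fun T => (h2 T).symm

theorem tsum_iSup_l1norm_FTheta_le (hμ : ‖(μ : ℂ)‖ₑ = 1) {g g' : Ed d → ℂ} (hg : Measurable g)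
    (hgg' : g' =ᵐ[volume] g) {T₀ : ℝ} (hT₀ : ENNReal.ofReal T₀ * l1norm g ^ 4 * 32 ≤ 1) :
    ∑' j : ℕ, ⨆ t ∈ Icc (0:ℝ) T₀, l1norm (FTheta d μ g' j t) ≤ l1norm g * 2 := by
  set A := ENNReal.ofReal T₀ * l1norm g ^ 4 with hA
  have h1 : ∀ j : ℕ, ⨆ t ∈ Icc (0:ℝ) T₀, l1norm (FTheta d μ g' j t) ≤
      ∑' T : {T : Tree5 // T.internal = j}, l1norm g * A ^ (T : Tree5).internal := by
    intro j
    refine iSup₂_le fun t ht => ?_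
    calc l1norm (FTheta d μ g' j t)
        = ∫⁻ ξ, ‖∑' T : {T : Tree5 // T.internal = j}, FPsi d μ g T t ξ‖ₑ := by
          refine lintegral_congr_ae ?_
          filter_upwards [FPsi_congr_all (μ := μ) hgg' t] with ξ hξ
          simp only [FTheta, hξ]
      _ ≤ ∫⁻ ξ, ∑' T : {T : Tree5 // T.internal = j}, ‖FPsi d μ g T t ξ‖ₑ :=
          lintegral_mono fun ξ => enorm_tsum_le_tsum_enorm
      _ = ∑' T : {T : Tree5 // T.internal = j}, l1norm (FPsi d μ g T t) :=
          lintegral_tsum fun T =>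
            (measurable_slice (measurable_FPsi hg (T : Tree5)) t).enorm.aemeasurable
      _ ≤ _ := ENNReal.tsum_le_tsum fun T => l1norm_FPsi_le hμ hg T ht
  refine (ENNReal.tsum_le_tsum h1).trans ?_
  rw [← tsum_tree_eq_tsum_internal_ennreal fun T => l1norm g * A ^ T.internal]
  rw [ENNReal.tsum_mul_left]
  gcongr
  exact tsum_pow_internal_le hT₀

end Trees

section Uniqueness

variable {d : ℕ}

theorem l1norm_neg_sub (f g : Ed d → ℂ) : l1norm (f - g) = l1norm (g - f) := by
  simp only [l1norm, Pi.sub_apply, enorm_sub_rev]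

theorem l1norm_sub_le_add {f g : Ed d → ℂ} (hf : Measurable f) (h : Ed d → ℂ) (hg : Measurable g) :
    l1norm (f - h) ≤ l1norm (f - g) + l1norm (g - h) := by
  unfold l1norm
  rw [← lintegral_add_left (hf.sub hg).enorm]
  refine lintegral_mono fun ξ => ?_
  simp only [Pi.sub_apply]
  rw [← sub_add_sub_cancel (f ξ) (g ξ) (h ξ)]
  exact enorm_add_le _ _

/-- A continuous curve in `L¹` has a jointly measurable representative. -/
theorem exists_measurable_representative {f : ℝ → Ed d → ℂ} (hm : ∀ t, Measurable (f t))
    (hc : ∀ t₀, Tendsto (fun t => l1norm (f t - f t₀)) (𝓝 t₀) (𝓝 0)) :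
    ∃ W : ℝ → Ed d → ℂ, Measurable (Function.uncurry W) ∧ ∀ t, W t =ᵐ[volume] f t := by
  classical
  let q := TopologicalSpace.denseSeq ℝ
  let ε : ℕ → ℝ≥0∞ := fun n => 2⁻¹ ^ n
  have hε : ∀ n, 0 < ε n := fun n => ENNReal.pow_pos (by simp) n
  have hex : ∀ n t, ∃ k, l1norm (f (q k) - f t) < ε n := by
    intro n t
    have hev := (hc t).eventually (Iio_mem_nhds (hε n))
    obtain ⟨_, ⟨k, rfl⟩, hx⟩ :=
      (TopologicalSpace.denseRange_denseSeq ℝ).inter_nhds_nonempty hev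
    exact ⟨k, hx⟩
  have hopen : ∀ n k, IsOpen {t | l1norm (f (q k) - f t) < ε n} := by
    intro n k
    refine isOpen_iff_mem_nhds.2 fun t₀ ht₀ => ?_
    have hev := (hc t₀).eventually (Iio_mem_nhds (tsub_pos_of_lt ht₀))
    filter_upwards [hev] with t ht
    refine (l1norm_sub_le_add (hm _) _ (hm t₀)).trans_lt ?_
    rw [l1norm_neg_sub (f t₀)]
    exact lt_tsub_iff_left.1 ht
  let G : ℕ → ℝ × Ed d → ℂ := fun n x => f (q (Nat.find (hex n x.1))) x.2
  have hG : ∀ n, Measurable (G n) := fun n =>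
    Measurable.find (f := fun k (x : ℝ × Ed d) => f (q k) x.2)
      (p := fun k (x : ℝ × Ed d) => l1norm (f (q k) - f x.1) < ε n)
      (fun k => (hm _).comp measurable_snd)
      (fun k => measurable_fst (hopen n k).measurableSet) fun x => hex n x.1
  refine ⟨fun t ξ => limUnder atTop fun n => G n (t, ξ), ?_, fun t => ?_⟩
  · exact (StronglyMeasurable.limUnder (l := atTop)
      fun n => (hG n).stronglyMeasurable).measurable
  · have hs : ∑' n, l1norm (f (q (Nat.find (hex n t))) - f t) ≠ ⊤ := by
      refine ne_top_of_le_ne_top ?_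
        (ENNReal.tsum_le_tsum fun n => (Nat.find_spec (hex n t)).le)
      simp [ε, ENNReal.tsum_geometric]
    filter_upwards [ae_tsum_enorm_ne_top (fun n => (hm _).sub (hm t)) hs] with ξ hξ
    refine Tendsto.limUnder_eq (tendsto_iff_edist_tendsto_0.2 ?_)
    simp only [edist_eq_enorm_sub]
    exact ENNReal.tendsto_atTop_zero_of_tsum_ne_top hξ

theorem eq_zero_of_le_mul_lintegral {φ : ℝ → ℝ≥0∞} {T : ℝ} {K B : ℝ≥0∞} (hK : K ≠ ⊤)
    (hB : B ≠ ⊤) (hφ : ∀ t ∈ Icc 0 T, φ t ≤ B)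
    (h : ∀ t ∈ Icc 0 T, φ t ≤ K * ∫⁻ τ in Ioc 0 t, φ τ) : ∀ t ∈ Icc 0 T, φ t = 0 := by
  lift K to NNReal using hK with k
  have hn : ∀ n : ℕ, ∀ t ∈ Icc 0 T,
      φ t ≤ B * ENNReal.ofReal ((k * t) ^ n / n.factorial) := by
    intro n
    induction n with
    | zero => simpa using hφ
    | succ n ih =>
      intro t ht
      have hint : ∫⁻ τ in Ioc 0 t, ENNReal.ofReal ((k * τ) ^ n / n.factorial) =
          ENNReal.ofReal (k ^ n * t ^ (n + 1) / (n + 1).factorial) := by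
        rw [← ofReal_integral_eq_lintegral_ofReal]
        · congr 1
          rw [← intervalIntegral.integral_of_le ht.1]
          simp only [mul_pow, intervalIntegral.integral_div, intervalIntegral.integral_const_mul,
            integral_pow]
          rw [Nat.factorial_succ]
          push_cast
          field_simp
          simp
        · exact (by fun_prop : Continuous fun τ : ℝ => ((k : ℝ) * τ) ^ n / n.factorial)
            |>.integrableOn_Ioc
        · filter_upwards [ae_restrict_mem measurableSet_Ioc] with τ hτ
          have := hτ.1.le
          simp only [Pi.zero_apply]
          positivity
      calc φ t ≤ k * ∫⁻ τ in Ioc 0 t, φ τ := h t ht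
        _ ≤ k * ∫⁻ τ in Ioc 0 t, B * ENNReal.ofReal ((k * τ) ^ n / n.factorial) := by
          refine mul_le_mul_right ?_ _
          exact setLIntegral_mono' measurableSet_Ioc fun τ hτ =>
            ih τ ⟨hτ.1.le, hτ.2.trans ht.2⟩
        _ = B * (ENNReal.ofReal k * ENNReal.ofReal (k ^ n * t ^ (n + 1) / (n + 1).factorial)) := by
          rw [lintegral_const_mul' _ _ hB, hint, ENNReal.ofReal_coe_nnreal]
          ring
        _ = B * ENNReal.ofReal ((k * t) ^ (n + 1) / (n + 1).factorial) := by
          rw [← ENNReal.ofReal_mul k.coe_nonneg]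
          congr 2
          ring
  intro t ht
  have hlim : Tendsto (fun n : ℕ => B * ENNReal.ofReal ((k * t) ^ n / n.factorial)) atTop
      (𝓝 (B * ENNReal.ofReal 0)) :=
    ENNReal.Tendsto.const_mul (ENNReal.tendsto_ofReal
      (FloorSemiring.tendsto_pow_div_factorial_atTop _)) (Or.inr hB)
  rw [ENNReal.ofReal_zero, mul_zero] at hlim
  exact le_antisymm (ge_of_tendsto' hlim fun n => hn n t ht) zero_le

theorem lintegral_l1norm_quint_ne_top {V : ℝ → Ed d → ℂ} (hV : Measurable (Function.uncurry V))
    {T t : ℝ} {M : ℝ≥0∞} (hM : M ≠ ⊤) (bV : ∀ t ∈ Icc 0 T, l1norm (V t) ≤ M) (ht : t ≤ T) :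
    ∫⁻ τ in Ioc 0 t, l1norm (quint (V τ) (V τ) (V τ) (V τ) (V τ)) ≠ ⊤ := by
  refine ne_top_of_le_ne_top ?_ (setLIntegral_mono' (g := fun _ => M * M * M * M * M)
    measurableSet_Ioc fun τ hτ => ?_)
  · rw [setLIntegral_const, Real.volume_Ioc]
    exact ENNReal.mul_ne_top (by finiteness) ENNReal.ofReal_ne_top
  · have m := measurable_slice hV τ
    have b := bV τ ⟨hτ.1.le, hτ.2.trans ht⟩
    refine (l1norm_quint_le m m m m m).trans ?_
    gcongr

theorem ae_eq_of_duhamel {μ : ℝ} (hμ : ‖(μ : ℂ)‖ₑ = 1) {g : Ed d → ℂ} {V W : ℝ → Ed d → ℂ}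
    (hV : Measurable (Function.uncurry V)) (hW : Measurable (Function.uncurry W)) {T : ℝ}
    {M : ℝ≥0∞} (hM : M ≠ ⊤) (bV : ∀ t ∈ Icc 0 T, l1norm (V t) ≤ M)
    (bW : ∀ t ∈ Icc 0 T, l1norm (W t) ≤ M)
    (dV : ∀ t ∈ Icc 0 T, ∀ᵐ ξ : Ed d, V t ξ =
      Complex.exp (Complex.I * ((t : ℂ) * (‖ξ‖ : ℂ) ^ 4)) * g ξ +
      duhamel μ (fun τ => quint (V τ) (V τ) (V τ) (V τ) (V τ)) t ξ)
    (dW : ∀ t ∈ Icc 0 T, ∀ᵐ ξ : Ed d, W t ξ =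
      Complex.exp (Complex.I * ((t : ℂ) * (‖ξ‖ : ℂ) ^ 4)) * g ξ +
      duhamel μ (fun τ => quint (W τ) (W τ) (W τ) (W τ) (W τ)) t ξ) :
    ∀ t ∈ Icc 0 T, V t =ᵐ[volume] W t := by
  have mQV := measurable_quint_uncurry hV hV hV hV hV
  have mQW := measurable_quint_uncurry hW hW hW hW hW
  have hzero := eq_zero_of_le_mul_lintegral (φ := fun t => l1norm (V t - W t)) (T := T)
    (K := 5 * M ^ 4) (B := M + M) (by finiteness) (by finiteness) ?_ ?_
  · intro t ht
    have h := hzero t ht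
    simp only [l1norm] at h
    rw [lintegral_eq_zero_iff ((measurable_slice hV t).sub (measurable_slice hW t)).enorm] at h
    filter_upwards [h] with ξ hξ
    simpa [sub_eq_zero] using hξ
  · intro t ht
    have := l1norm_sub_le_add (g := 0) (measurable_slice hV t) (W t) measurable_const
    rw [sub_zero, l1norm_neg_sub 0, sub_zero] at this
    exact this.trans (add_le_add (bV t ht) (bW t ht))
  · intro t ht
    have fV := lintegral_l1norm_quint_ne_top hV hM bV ht.2
    have fW := lintegral_l1norm_quint_ne_top hW hM bW ht.2
    have h1 : V t - W t =ᵐ[volume] duhamel μ (fun τ => quint (V τ) (V τ) (V τ) (V τ) (V τ) -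
        quint (W τ) (W τ) (W τ) (W τ) (W τ)) t := by
      refine EventuallyEq.trans ?_ (duhamel_sub_ae mQV mQW ht.1 fV fW)
      filter_upwards [dV t ht, dW t ht] with ξ h2 h3
      simp only [Pi.sub_apply, h2, h3, add_sub_add_left_eq_sub]
    calc l1norm (V t - W t)
        ≤ ∫⁻ τ in Ioc 0 t, l1norm (quint (V τ) (V τ) (V τ) (V τ) (V τ) -
            quint (W τ) (W τ) (W τ) (W τ) (W τ)) := by
          rw [l1norm_congr h1]
          exact l1norm_duhamel_le hμ (mQV.sub mQW) ht.1
      _ ≤ ∫⁻ τ in Ioc 0 t, 5 * M ^ 4 * l1norm (V τ - W τ) :=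
          setLIntegral_mono' measurableSet_Ioc fun τ hτ =>
            have hτ' : τ ∈ Icc 0 T := ⟨hτ.1.le, hτ.2.trans ht.2⟩
            l1norm_quint_sub_le (measurable_slice hV τ) (measurable_slice hW τ) hM (bV τ hτ')
              (bW τ hτ')
      _ = 5 * M ^ 4 * ∫⁻ τ in Ioc 0 t, l1norm (V τ - W τ) :=
          lintegral_const_mul' _ _ (by finiteness)

theorem mul_integral_flow_eq_duhamel (μ : ℝ) (H : ℝ → Ed d → ℂ) (t : ℝ) (ξ : Ed d) :
    Complex.I * (μ : ℂ) * ∫ τ in (0:ℝ)..t,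
      Complex.exp (Complex.I * (((t - τ : ℝ) : ℂ) * (‖ξ‖ : ℂ) ^ 4)) * H τ ξ =
    duhamel μ H t ξ := by
  rw [duhamel, mul_assoc _ (Complex.exp _)]
  congr 1
  rw [← intervalIntegral.integral_const_mul]
  congr 1
  funext τ
  rw [← mul_assoc (Complex.exp _), ← Complex.exp_add]
  congr 2
  push_cast
  ring

/-- A mild solution has a jointly measurable representative, bounded in `L¹`, which solves the
Duhamel equation. -/
theorem IsMildFL1Solution.exists_representative {μ T : ℝ} {u g : Ed d → ℂ} {U : ℝ → Ed d → ℂ}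
    (hT : 0 ≤ T) (hu : u =ᵐ[volume] g) (h : IsMildFL1Solution d μ T u U) :
    ∃ W : ℝ → Ed d → ℂ, Measurable (Function.uncurry W) ∧
      (∀ t ∈ Icc 0 T, W t =ᵐ[volume] U t) ∧
      (∃ M : ℝ≥0∞, M ≠ ⊤ ∧ ∀ t ∈ Icc 0 T, l1norm (W t) ≤ M) ∧
      ∀ t ∈ Icc 0 T, ∀ᵐ ξ : Ed d, W t ξ =
        Complex.exp (Complex.I * ((t : ℂ) * (‖ξ‖ : ℂ) ^ 4)) * g ξ +
        duhamel μ (fun τ => quint (W τ) (W τ) (W τ) (W τ) (W τ)) t ξ := by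
  obtain ⟨hint, hcont, hduh⟩ := h
  have hint' : ∀ t, Integrable (U (projIcc 0 T hT t)) := fun t => hint _ (projIcc 0 T hT t).2
  let f : ℝ → Ed d → ℂ := fun t => (hint' t).1.mk
  have hfU : ∀ t, f t =ᵐ[volume] U (projIcc 0 T hT t) := fun t => (hint' t).1.ae_eq_mk.symm
  have hcont' : ∀ t₀ ∈ Icc 0 T, Tendsto (fun t => l1norm (U t - U t₀)) (𝓝[Icc 0 T] t₀) (𝓝 0) := by
    simpa only [eLpNorm_one_eq_l1norm] using hcont
  obtain ⟨W, hWm, hW⟩ := exists_measurable_representative (f := f)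
    (fun t => (hint' t).1.stronglyMeasurable_mk.measurable) (by
      intro t₀
      have hp : Tendsto (fun t => (projIcc 0 T hT t : ℝ)) (𝓝 t₀)
          (𝓝[Icc 0 T] (projIcc 0 T hT t₀ : ℝ)) :=
        tendsto_nhdsWithin_iff.2 ⟨(continuous_subtype_val.comp continuous_projIcc).tendsto t₀,
          Eventually.of_forall fun t => (projIcc 0 T hT t).2⟩
      refine ((hcont' _ (projIcc 0 T hT t₀).2).comp hp).congr fun t => ?_
      exact l1norm_congr ((hfU t).symm.sub (hfU t₀).symm))
  have hWU : ∀ t ∈ Icc 0 T, W t =ᵐ[volume] U t := by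
    intro t ht
    have := (hW t).trans (hfU t)
    rwa [projIcc_of_mem hT ht] at this
  refine ⟨W, hWm, hWU, ?_, ?_⟩
  · have hb : ∃ M : ℝ≥0∞, M ≠ ⊤ ∧ ∀ t ∈ Icc 0 T, t ∈ Icc 0 T → l1norm (W t) ≤ M := by
      refine isCompact_Icc.induction_on (p := fun s => ∃ M : ℝ≥0∞, M ≠ ⊤ ∧ ∀ t ∈ s, t ∈ Icc 0 T →
        l1norm (W t) ≤ M) ⟨0, by simp⟩ ?_ ?_ ?_
      · rintro s s' hs ⟨M, hM, hb⟩
        exact ⟨M, hM, fun t ht => hb t (hs ht)⟩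
      · rintro s s' ⟨M, hM, hb⟩ ⟨M', hM', hb'⟩
        refine ⟨M + M', ENNReal.add_ne_top.2 ⟨hM, hM'⟩, fun t ht htI => ?_⟩
        rcases ht with ht | ht
        · exact (hb t ht htI).trans le_self_add
        · exact (hb' t ht htI).trans le_add_self
      · intro t₀ ht₀
        refine ⟨{t | l1norm (U t - U t₀) < 1}, (hcont' t₀ ht₀).eventually
          (Iio_mem_nhds one_pos), 1 + l1norm (W t₀), ?_, fun t ht htI => ?_⟩
        · rw [l1norm_congr (hWU t₀ ht₀)]
          exact ENNReal.add_ne_top.2 ⟨ENNReal.one_ne_top, (hint t₀ ht₀).2.ne⟩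
        · have h := l1norm_sub_le_add (measurable_slice hWm t) 0 (measurable_slice hWm t₀)
          rw [sub_zero, sub_zero, l1norm_congr ((hWU t htI).sub (hWU t₀ ht₀))] at h
          exact h.trans (add_le_add (le_of_lt ht) le_rfl)
    obtain ⟨M, hM, hb⟩ := hb
    exact ⟨M, hM, fun t ht => hb t ht ht⟩
  · intro t ht
    filter_upwards [hWU t ht, hu, hduh t ht] with ξ h1 h2 h3
    rw [h1, h3, h2, ← mul_integral_flow_eq_duhamel]
    congr 2
    refine intervalIntegral.integral_congr fun τ hτ => ?_
    rw [uIcc_of_le ht.1] at hτ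
    have := quint_congr (hWU τ ⟨hτ.1, hτ.2.trans ht.2⟩)
    simp only [this]
    rfl

end Uniqueness

/-- **Proposition 2.3**: local well-posedness in `FL¹` on `[0,T]` with
`T = δ‖û₀‖_{L¹}^{-4}`, together with the Picard series expansion
`û(t) = Σ_j F[Θ_j(u₀)(t)]`, the series converging absolutely in `L¹`, uniformly in `t`. -/
theorem FL1_local_wellposedness_and_series (d : ℕ) (hd : 1 ≤ d)
    (μ : ℝ) (hμ : μ = 1 ∨ μ = -1) :
    ∃ δ > (0:ℝ), ∀ u0hat : Ed d → ℂ, Integrable u0hat →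
      ∃ U : ℝ → Ed d → ℂ,
        IsMildFL1Solution d μ (δ / (∫ ξ, ‖u0hat ξ‖) ^ 4) u0hat U ∧
        (∀ U' : ℝ → Ed d → ℂ,
          IsMildFL1Solution d μ (δ / (∫ ξ, ‖u0hat ξ‖) ^ 4) u0hat U' →
          ∀ t ∈ Icc (0:ℝ) (δ / (∫ ξ, ‖u0hat ξ‖) ^ 4), U' t =ᵐ[volume] U t) ∧
        (∀ t ∈ Icc (0:ℝ) (δ / (∫ ξ, ‖u0hat ξ‖) ^ 4),
          ∀ᵐ ξ : Ed d, U t ξ = ∑' j : ℕ, FTheta d μ u0hat j t ξ) ∧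
        (∑' j : ℕ, ⨆ t ∈ Icc (0:ℝ) (δ / (∫ ξ, ‖u0hat ξ‖) ^ 4),
            eLpNorm (FTheta d μ u0hat j t) 1 volume) ≠ ⊤ := by
  have hμ' : ‖(μ : ℂ)‖ₑ = 1 := by rcases hμ with rfl | rfl <;> simp
  refine ⟨1 / 32, by norm_num, fun u0hat hu => ?_⟩
  set T₀ : ℝ := 1 / 32 / (∫ ξ, ‖u0hat ξ‖) ^ 4 with hT₀_def
  have hnorm : 0 ≤ ∫ ξ, ‖u0hat ξ‖ := integral_nonneg fun _ => norm_nonneg _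
  have hT₀_nonneg : 0 ≤ T₀ := by positivity
  let g : Ed d → ℂ := hu.1.mk
  have hgg' : u0hat =ᵐ[volume] g := hu.1.ae_eq_mk
  have hg : Measurable g := hu.1.stronglyMeasurable_mk.measurable
  have hg_norm : l1norm g = ENNReal.ofReal (∫ ξ, ‖u0hat ξ‖) :=
    (l1norm_congr hgg').symm.trans (ofReal_integral_norm_eq_lintegral_enorm hu).symm
  have hgf : l1norm g ≠ ⊤ := hg_norm ▸ ENNReal.ofReal_ne_top
  have hT₀ : ENNReal.ofReal T₀ * l1norm g ^ 4 * 32 ≤ 1 := by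
    rw [hg_norm, ← ENNReal.ofReal_pow hnorm, ← ENNReal.ofReal_mul hT₀_nonneg,
      ← ENNReal.ofReal_ofNat 32, ← ENNReal.ofReal_mul (by positivity)]
    refine ENNReal.ofReal_le_one.2 ?_
    calc T₀ * (∫ ξ, ‖u0hat ξ‖) ^ 4 * 32
        = (∫ ξ, ‖u0hat ξ‖) ^ 4 / (∫ ξ, ‖u0hat ξ‖) ^ 4 := by
          rw [hT₀_def]
          ring
      _ ≤ 1 := div_self_le_one _
  have hbound : ∀ t ∈ Icc 0 T₀, l1norm (treeSum d μ g t) ≤ l1norm g * 2 := fun t ht =>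
    (isL1Sum_treeSum hμ' hg hgf hT₀ ht).l1norm_le.trans (tsum_l1norm_FPsi_le hμ' hg hT₀ ht)
  have hM : l1norm g * 2 ≠ ⊤ := ENNReal.mul_ne_top hgf ENNReal.ofNat_ne_top
  have hS : Measurable (Function.uncurry (treeSum d μ g)) := measurable_treeSum hg
  have hduh := fun t (ht : t ∈ Icc 0 T₀) => treeSum_duhamel_ae hμ' hg hgf hT₀ ht
  refine ⟨treeSum d μ g, ⟨fun t ht => ?_, fun t₀ ht₀ => ?_, fun t ht => ?_⟩,
    fun U' hU' t ht => ?_, fun t ht => tsum_FTheta_ae_eq_treeSum hμ' hg hgf hgg' hT₀ ht, ?_⟩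
  · exact ⟨(measurable_slice hS t).aestronglyMeasurable,
      (hbound t ht).trans_lt (lt_top_iff_ne_top.2 hM)⟩
  · simp only [eLpNorm_one_eq_l1norm]
    refine (tendsto_l1norm_flow_add_duhamel hμ' hg hgf
      (measurable_quint_uncurry hS hS hS hS hS)
      (lintegral_l1norm_quint_ne_top hS hM hbound le_rfl) ht₀).congr' ?_
    filter_upwards [self_mem_nhdsWithin] with t ht
    refine l1norm_congr ?_
    filter_upwards [hduh t ht, hduh t₀ ht₀] with ξ h1 h2
    rw [Pi.sub_apply, h1, h2]
  · filter_upwards [hduh t ht, hgg'] with ξ h1 h2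
    rw [h1, h2, ← mul_integral_flow_eq_duhamel]
    rfl
  · obtain ⟨W, hW, hWU, ⟨M, hM', hWM⟩, hWd⟩ := hU'.exists_representative hT₀_nonneg hgg'
    exact (hWU t ht).symm.trans (ae_eq_of_duhamel hμ' hW hS (ENNReal.add_ne_top.2 ⟨hM', hM⟩)
      (fun s hs => (hWM s hs).trans le_self_add) (fun s hs => (hbound s hs).trans le_add_self)
      hWd hduh t ht)
  · simp only [eLpNorm_one_eq_l1norm]
    exact ne_top_of_le_ne_top hM (tsum_iSup_l1norm_FTheta_le hμ' hg hgg' hT₀)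
end
end

section
/- (Equation (2.17): size of the perturbation φ_{R,A,N}.) Let d ≥ 1 be an integer and s < 0. Then for all R, A, N > 0: ‖φ_{R,A,N}‖_{FL¹} = 2 R A^d. Moreover there exist constants c, C > 0, depending only on d and s, such that whenever 2 ≤ A and √d · A ≤ N, one has c R A^{d/2} N^s ≤ ‖φ_{R,A,N}‖_{H^s} ≤ C R A^{d/2} N^s. -/
open MeasureTheory Set
open scoped ENNReal

noncomputable section

/-- The cube `Q_A = [−A/2, A/2)^d ⊂ ℝ^d`. -/
def QA (d : ℕ) (A : ℝ) : Set (Ed d) := {ξ | ∀ i, ξ i ∈ Ico (-(A / 2)) (A / 2)}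

/-- The indicator function (ℂ-valued) of the translated cube `a + Q_A`. -/
def cubeIndC (d : ℕ) (A : ℝ) (a : Ed d) : Ed d → ℂ :=
  Set.indicator {ξ | ξ - a ∈ QA d A} (fun _ => 1)

/-- The first standard basis vector `e₁` of `ℝ^d`. -/
def e1 (d : ℕ) (hd : 0 < d) : Ed d := EuclideanSpace.single (⟨0, hd⟩ : Fin d) (1 : ℝ)

/-- The Fourier transform `φ̂_{R,A,N} = R (1_{N e₁+Q_A} + 1_{2N e₁+Q_A})` of the
perturbation `φ_{R,A,N}`. -/
def phiHat (d : ℕ) (hd : 0 < d) (R A N : ℝ) : Ed d → ℂ := fun ξ =>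
  (R : ℂ) * (cubeIndC d A (N • e1 d hd) ξ + cubeIndC d A ((2 * N) • e1 d hd) ξ)

/-- The `H^s` norm computed from the Fourier transform `g = f̂`:
`(∫ (1+|ξ|²)^s |g(ξ)|² dξ)^{1/2}`. -/
def hSobHat {d : ℕ} (s : ℝ) (g : Ed d → ℂ) : ℝ :=
  (∫ ξ : Ed d, (1 + ‖ξ‖ ^ 2) ^ s * ‖g ξ‖ ^ 2) ^ ((1 : ℝ) / 2)

/-- The translated cube `a + Q_A`. -/
def cubeAt (d : ℕ) (A : ℝ) (a : Ed d) : Set (Ed d) := {ξ | ξ - a ∈ QA d A}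

lemma cubeAt_eq_preimage (d : ℕ) (A : ℝ) (a : Ed d) :
    cubeAt d A a = (WithLp.ofLp : Ed d → Fin d → ℝ) ⁻¹'
      Set.pi univ (fun i => Ico (a i - A / 2) (a i + A / 2)) := by
  ext ξ
  simp only [cubeAt, QA, mem_ofPred_eq, mem_preimage, mem_univ_pi, mem_Ico, PiLp.sub_apply]
  refine forall_congr' fun i => and_congr ?_ ?_ <;> constructor <;> intro h <;> linarith

lemma measurableSet_cubeAt (d : ℕ) (A : ℝ) (a : Ed d) : MeasurableSet (cubeAt d A a) := by
  rw [cubeAt_eq_preimage]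
  exact (PiLp.volume_preserving_ofLp (Fin d)).measurable
    (MeasurableSet.univ_pi fun _ => measurableSet_Ico)

lemma volume_cubeAt (d : ℕ) {A : ℝ} (hA : 0 < A) (a : Ed d) :
    volume (cubeAt d A a) = ENNReal.ofReal (A ^ d) := by
  rw [cubeAt_eq_preimage, (PiLp.volume_preserving_ofLp (Fin d)).measure_preimage
    (MeasurableSet.univ_pi fun _ => measurableSet_Ico).nullMeasurableSet, Real.volume_pi_Ico]
  simp [ENNReal.ofReal_pow hA.le]

/-- The real-valued sum of the indicators of the cubes centred at `N e₁` and `2N e₁`. -/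
def cubeSum (d : ℕ) (hd : 0 < d) (A N : ℝ) : Ed d → ℝ :=
  (cubeAt d A (N • e1 d hd)).indicator 1 + (cubeAt d A ((2 * N) • e1 d hd)).indicator 1

lemma norm_phiHat (d : ℕ) (hd : 0 < d) {R : ℝ} (hR : 0 < R) (A N : ℝ) (ξ : Ed d) :
    ‖phiHat d hd R A N ξ‖ = R * cubeSum d hd A N ξ := by
  have h (a : Ed d) : cubeIndC d A a ξ = (((cubeAt d A a).indicator 1 ξ : ℝ) : ℂ) := by
    by_cases hξ : ξ ∈ cubeAt d A a
    · rw [indicator_of_mem hξ]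
      exact (indicator_of_mem hξ _).trans (by simp)
    · rw [indicator_of_notMem hξ]
      exact (indicator_of_notMem hξ _).trans (by simp)
  rw [phiHat, h, h, ← Complex.ofReal_add, ← Complex.ofReal_mul, Complex.norm_real,
    Real.norm_of_nonneg]
  · rfl
  · exact mul_nonneg hR.le (add_nonneg (indicator_nonneg (fun _ _ => zero_le_one) _)
      (indicator_nonneg (fun _ _ => zero_le_one) _))

lemma measurable_cubeSum (d : ℕ) (hd : 0 < d) (A N : ℝ) : Measurable (cubeSum d hd A N) :=
  (measurable_one.indicator (measurableSet_cubeAt d A _)).add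
    (measurable_one.indicator (measurableSet_cubeAt d A _))

lemma integrable_indicator_cubeAt (d : ℕ) {A : ℝ} (hA : 0 < A) (a : Ed d) :
    Integrable ((cubeAt d A a).indicator (1 : Ed d → ℝ)) := by
  refine (integrable_indicator_iff (measurableSet_cubeAt d A a)).2 (integrableOn_const ?_)
  simp [volume_cubeAt d hA]

lemma integrable_cubeSum (d : ℕ) (hd : 0 < d) {A : ℝ} (hA : 0 < A) (N : ℝ) :
    Integrable (cubeSum d hd A N) :=
  (integrable_indicator_cubeAt d hA _).add (integrable_indicator_cubeAt d hA _)

lemma integral_cubeSum (d : ℕ) (hd : 0 < d) {A : ℝ} (hA : 0 < A) (N : ℝ) :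
    ∫ ξ, cubeSum d hd A N ξ = 2 * A ^ d := by
  have h (a : Ed d) : ∫ ξ, (cubeAt d A a).indicator (1 : Ed d → ℝ) ξ = A ^ d := by
    rw [integral_indicator_one (measurableSet_cubeAt d A a), measureReal_def,
      volume_cubeAt d hA, ENNReal.toReal_ofReal (by positivity)]
  unfold cubeSum
  rw [integral_add' (integrable_indicator_cubeAt d hA _) (integrable_indicator_cubeAt d hA _),
    h, h, two_mul]

lemma eLpNorm_phiHat_one (d : ℕ) (hd : 0 < d) {R A : ℝ} (hR : 0 < R) (hA : 0 < A) (N : ℝ) :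
    eLpNorm (phiHat d hd R A N) 1 volume = ENNReal.ofReal (2 * R * A ^ d) := by
  have h : eLpNorm (phiHat d hd R A N) 1 volume =
      eLpNorm (fun ξ => R * cubeSum d hd A N ξ) 1 volume :=
    eLpNorm_congr_norm_ae (.of_forall fun ξ => by
      rw [← norm_phiHat d hd hR A N ξ, norm_norm])
  rw [h, eLpNorm_one_eq_lintegral_enorm,
    ← ofReal_integral_norm_eq_lintegral_enorm ((integrable_cubeSum d hd hA N).const_mul R)]
  simp_rw [← norm_phiHat d hd hR A N, norm_norm, norm_phiHat d hd hR A N]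
  rw [integral_const_mul, integral_cubeSum d hd hA]
  ring_nf

lemma norm_le_of_mem_QA {d : ℕ} {A : ℝ} (hA : 0 < A) {η : Ed d} (hη : η ∈ QA d A) :
    ‖η‖ ≤ Real.sqrt d * A / 2 := by
  have h : ‖η‖ ^ 2 ≤ (Real.sqrt d * A / 2) ^ 2 := by
    rw [EuclideanSpace.norm_sq_eq, div_pow, mul_pow, Real.sq_sqrt d.cast_nonneg]
    calc ∑ i, ‖η i‖ ^ 2 ≤ ∑ _i : Fin d, (A / 2) ^ 2 :=
          Finset.sum_le_sum fun i _ => by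
            have := hη i
            exact pow_le_pow_left₀ (norm_nonneg _) (abs_le.2 ⟨this.1, this.2.le⟩) 2
      _ = d * A ^ 2 / 2 ^ 2 := by simp; ring
  exact le_of_sq_le_sq h (by positivity)

lemma japanese_bracket_bounds {d : ℕ} (hd : 0 < d) {A N t : ℝ} (hA : 2 ≤ A)
    (hN : Real.sqrt d * A ≤ N) (ht : N ≤ t) (ht' : t ≤ 2 * N) {ξ : Ed d}
    (hξ : ξ ∈ cubeAt d A (t • e1 d hd)) :
    1 / 4 * N ^ 2 ≤ 1 + ‖ξ‖ ^ 2 ∧ 1 + ‖ξ‖ ^ 2 ≤ 8 * N ^ 2 := by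
  have hd1 : 1 ≤ Real.sqrt d := Real.one_le_sqrt.2 (by exact_mod_cast hd)
  have hAN : A ≤ N := by nlinarith
  have hlow : N / 2 ≤ ‖ξ‖ := by
    have h0 := (hξ ⟨0, hd⟩).1
    have h1 : ξ ⟨0, hd⟩ ≤ ‖ξ‖ := (le_abs_self _).trans (PiLp.norm_apply_le ξ ⟨0, hd⟩)
    simp [e1] at h0
    linarith
  have hup : ‖ξ‖ ≤ 5 / 2 * N := by
    have h0 := norm_le_of_mem_QA (by linarith) hξ
    have h1 : ‖t • e1 d hd‖ = t := by
      simp [norm_smul, e1, abs_of_nonneg (show 0 ≤ t by linarith)]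
    have h2 := norm_le_norm_sub_add ξ (t • e1 d hd)
    linarith
  constructor <;> nlinarith [norm_nonneg ξ]

lemma hSob_integrand_bounds {d : ℕ} (hd : 0 < d) {s : ℝ} (hs : s < 0) {R A N : ℝ} (hR : 0 < R)
    (hA : 2 ≤ A) (hN : Real.sqrt d * A ≤ N) (hN0 : 0 < N) (ξ : Ed d) :
    (8 * N ^ 2) ^ s * R ^ 2 * cubeSum d hd A N ξ
        ≤ (1 + ‖ξ‖ ^ 2) ^ s * ‖phiHat d hd R A N ξ‖ ^ 2 ∧
      (1 + ‖ξ‖ ^ 2) ^ s * ‖phiHat d hd R A N ξ‖ ^ 2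
        ≤ (1 / 4 * N ^ 2) ^ s * R ^ 2 * 2 * cubeSum d hd A N ξ := by
  rw [norm_phiHat d hd hR]
  set u := cubeSum d hd A N ξ with hu
  have key : u = 0 ∨
      (1 ≤ u ∧ u ≤ 2 ∧ 1 / 4 * N ^ 2 ≤ 1 + ‖ξ‖ ^ 2 ∧ 1 + ‖ξ‖ ^ 2 ≤ 8 * N ^ 2) := by
    rw [cubeSum, Pi.add_apply] at hu
    by_cases h1 : ξ ∈ cubeAt d A (N • e1 d hd)
    · have hb := japanese_bracket_bounds hd hA hN le_rfl (by linarith) h1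
      by_cases h2 : ξ ∈ cubeAt d A ((2 * N) • e1 d hd) <;>
        simp [h1, h2] at hu <;> norm_num [hu, -one_div] <;> simpa using hb
    · by_cases h2 : ξ ∈ cubeAt d A ((2 * N) • e1 d hd)
      · have hb := japanese_bracket_bounds hd hA hN (by linarith) le_rfl h2
        simp [h1, h2] at hu
        norm_num [hu, -one_div]
        simpa using hb
      · left
        simpa [h1, h2] using hu
  obtain h0 | ⟨h1, h2, hlow, hup⟩ := key
  · simp [h0]
  have hl : (8 * N ^ 2) ^ s ≤ (1 + ‖ξ‖ ^ 2) ^ s :=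
    Real.rpow_le_rpow_of_nonpos (by positivity) hup hs.le
  have hr : (1 + ‖ξ‖ ^ 2) ^ s ≤ (1 / 4 * N ^ 2) ^ s :=
    Real.rpow_le_rpow_of_nonpos (by positivity) hlow hs.le
  rw [mul_assoc, mul_assoc, mul_assoc]
  constructor
  · refine mul_le_mul hl ?_ (by positivity) (by positivity)
    rw [mul_pow]
    exact mul_le_mul_of_nonneg_left (by nlinarith) (by positivity)
  · refine mul_le_mul hr ?_ (by positivity) (by positivity)
    rw [mul_pow]
    exact mul_le_mul_of_nonneg_left (by nlinarith) (by positivity)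

lemma integral_hSob_bounds {d : ℕ} (hd : 0 < d) {s : ℝ} (hs : s < 0) {R A N : ℝ} (hR : 0 < R)
    (hA : 2 ≤ A) (hN : Real.sqrt d * A ≤ N) (hN0 : 0 < N) :
    (8 * N ^ 2) ^ s * R ^ 2 * (2 * A ^ d)
        ≤ ∫ ξ, (1 + ‖ξ‖ ^ 2) ^ s * ‖phiHat d hd R A N ξ‖ ^ 2 ∧
      ∫ ξ, (1 + ‖ξ‖ ^ 2) ^ s * ‖phiHat d hd R A N ξ‖ ^ 2
        ≤ (1 / 4 * N ^ 2) ^ s * R ^ 2 * 2 * (2 * A ^ d) := by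
  have hA0 : 0 < A := by linarith
  have hb := hSob_integrand_bounds hd hs hR hA hN hN0
  have hu (k : ℝ) := (integrable_cubeSum d hd hA0 N).const_mul k
  have hint : Integrable fun ξ => (1 + ‖ξ‖ ^ 2) ^ s * ‖phiHat d hd R A N ξ‖ ^ 2 := by
    refine (hu ((1 / 4 * N ^ 2) ^ s * R ^ 2 * 2)).mono' ?_ (.of_forall fun ξ => ?_)
    · simp_rw [norm_phiHat d hd hR]
      have := measurable_cubeSum d hd A N
      exact Measurable.aestronglyMeasurable (by fun_prop)
    · rw [Real.norm_of_nonneg (by positivity)]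
      exact (hb ξ).2
  rw [← integral_cubeSum d hd hA0 N, ← integral_const_mul, ← integral_const_mul]
  exact ⟨integral_mono (hu _) hint fun ξ => (hb ξ).1, integral_mono hint (hu _) fun ξ => (hb ξ).2⟩

lemma sqrt_size_eq {d : ℕ} {s k m R A N : ℝ} (hk : 0 ≤ k) (hm : 0 ≤ m) (hR : 0 ≤ R) (hA : 0 ≤ A)
    (hN : 0 ≤ N) :
    ((k * N ^ 2) ^ s * R ^ 2 * (m * A ^ d)) ^ ((1 : ℝ) / 2) =
      (k ^ s * m) ^ ((1 : ℝ) / 2) * (R * A ^ ((d : ℝ) / 2) * N ^ s) := by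
  have hsq : (k * N ^ 2) ^ s * R ^ 2 * (m * A ^ d) =
      k ^ s * m * (R * A ^ ((d : ℝ) / 2) * N ^ s) ^ 2 := by
    have h1 : (A ^ ((d : ℝ) / 2)) ^ 2 = A ^ d := by
      rw [← Real.rpow_mul_natCast hA, ← Real.rpow_natCast]
      norm_num
    rw [Real.mul_rpow hk (by positivity), ← Real.rpow_pow_comm hN, mul_pow, mul_pow, h1]
    ring
  rw [hsq, Real.mul_rpow (by positivity) (by positivity)]
  congr 1
  rw [← Real.sqrt_eq_rpow, Real.sqrt_sq (by positivity)]

/-- **Equation (2.17)**: size of the perturbation `φ_{R,A,N}`: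
`‖φ_{R,A,N}‖_{FL¹} = 2 R A^d`, and `‖φ_{R,A,N}‖_{H^s} ∼ R A^{d/2} N^s` provided `2 ≤ A` and
`√d · A ≤ N`. -/
theorem perturbation_size (d : ℕ) (hd : 0 < d) (s : ℝ) (hs : s < 0) :
    (∀ R A N : ℝ, 0 < R → 0 < A → 0 < N →
      eLpNorm (phiHat d hd R A N) 1 volume = ENNReal.ofReal (2 * R * A ^ d)) ∧
    (∃ c > (0:ℝ), ∃ C > (0:ℝ), ∀ R A N : ℝ, 0 < R → 0 < A → 0 < N →
      2 ≤ A → Real.sqrt d * A ≤ N →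
        c * (R * A ^ ((d : ℝ) / 2) * N ^ s) ≤ hSobHat s (phiHat d hd R A N) ∧
        hSobHat s (phiHat d hd R A N) ≤ C * (R * A ^ ((d : ℝ) / 2) * N ^ s)) := by
  refine ⟨fun R A N hR hA _ => eLpNorm_phiHat_one d hd hR hA N,
    ((8 : ℝ) ^ s * 2) ^ ((1 : ℝ) / 2), by positivity,
    ((1 / 4 : ℝ) ^ s * 4) ^ ((1 : ℝ) / 2), by positivity,
    fun R A N hR hA hN hA2 hAN => ?_⟩
  obtain ⟨hlow, hup⟩ := integral_hSob_bounds hd hs hR hA2 hAN hN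
  rw [← sqrt_size_eq (by norm_num) (by norm_num) hR.le hA.le hN.le,
    ← sqrt_size_eq (by norm_num) (by norm_num) hR.le hA.le hN.le]
  refine ⟨Real.rpow_le_rpow (by positivity) hlow (by norm_num),
    Real.rpow_le_rpow ((by positivity : (0 : ℝ) ≤ _).trans hlow) (hup.trans_eq ?_) (by norm_num)⟩
  ring
end
end
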